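/- arXiv:1708.01782 — 2 statements merged into one kernel-verified Lean document; each statement's English description precedes it below -/
import Mathlib

section
/- Let F be a field of characteristic different from two, let p and q be forms over F, and let π be a Pfister form over F. Let K/F be any field extension such that π ⊗ p is isotropic over K. Then the Witt index of (π ⊗ q) over K satisfies i((π ⊗ q)_K) ≥ (dim π) · i(q_{F(p)}). -/
set_option synthInstance.maxHeartbeats 1000000
set_option maxHeartbeats 4000000

open scoped BigOperators Classical

namespace QF

section Defs

variable {R : Type*} [CommRing R]

/-- Evaluation of the diagonal quadratic form with coefficients `d` at the vector `v`. -/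
def evalQF {n : ℕ} (d : Fin n → R) (v : Fin n → R) : R := ∑ i, d i * v i ^ 2

/-- A form is isotropic if it represents zero non-trivially. -/
def Isotropic {n : ℕ} (d : Fin n → R) : Prop := ∃ v : Fin n → R, v ≠ 0 ∧ evalQF d v = 0

def Anisotropic {n : ℕ} (d : Fin n → R) : Prop := ¬ Isotropic d

/-- Nondegeneracy of a diagonal form: all coefficients are nonzero. -/
def Nondeg {n : ℕ} (d : Fin n → R) : Prop := ∀ i, d i ≠ 0

/-- Two diagonal forms are isometric if a linear equivalence matches their values. -/
def Isometric {m n : ℕ} (d : Fin m → R) (e : Fin n → R) : Prop :=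
  ∃ φ : (Fin m → R) ≃ₗ[R] (Fin n → R), ∀ v, evalQF e (φ v) = evalQF d v

/-- Orthogonal sum of diagonal forms. -/
def osum {m n : ℕ} (d : Fin m → R) (e : Fin n → R) : Fin (m + n) → R := Fin.append d e

/-- Tensor product of diagonal forms. -/
def tensorQF {m n : ℕ} (d : Fin m → R) (e : Fin n → R) : Fin (m * n) → R :=
  fun i => d (finProdFinEquiv.symm i).1 * e (finProdFinEquiv.symm i).2

/-- Scaling of a form by a scalar. -/
def smulQF {n : ℕ} (a : R) (d : Fin n → R) : Fin n → R := fun i => a * d i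

/-- `k` copies of the hyperbolic plane `⟨1,-1⟩`. -/
def hypform {R : Type*} [CommRing R] (k : ℕ) : Fin (k + k) → R :=
  Fin.append (fun _ => 1) (fun _ => -1)

/-- A form is hyperbolic if it is isometric to a sum of hyperbolic planes,
i.e. its Witt index is half its dimension. -/
def IsHyperbolic {n : ℕ} (d : Fin n → R) : Prop := ∃ k : ℕ, Isometric d (hypform k)

/-- The Witt index: the largest `k` such that `d ≅ k×⟨1,-1⟩ ⊥ r`. -/
noncomputable def WittIndex {n : ℕ} (d : Fin n → R) : ℕ :=
  sSup {k : ℕ | ∃ (m : ℕ) (r : Fin m → R), Isometric d (osum (hypform k) r)}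

/-- `r` is a subform of `d`: `d ≅ r ⊥ s` for some (nondegenerate) form `s`. -/
def Subform {m n : ℕ} (r : Fin m → R) (d : Fin n → R) : Prop :=
  ∃ (k : ℕ) (s : Fin k → R), Nondeg s ∧ Isometric d (osum r s)

/-- The set of nonzero represented values. -/
def Dset {n : ℕ} (d : Fin n → R) : Set R :=
  {a | a ≠ 0 ∧ ∃ v : Fin n → R, evalQF d v = a}

/-- The group of similarity factors `G(q) = {a : a·q ≅ q}`. -/
def Gset {n : ℕ} (d : Fin n → R) : Set R :=
  {a | a ≠ 0 ∧ Isometric (smulQF a d) d}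

/-- `H(q) = {a : ⟨1,-a⟩ ⊗ q is isotropic}`. -/
def Hset {n : ℕ} (d : Fin n → R) : Set R :=
  {a | a ≠ 0 ∧ Isotropic (tensorQF ![1, -a] d)}

/-- Base change of a form along a ring homomorphism (e.g. a field extension). -/
def bc {S : Type*} [CommRing S] (f : R →+* S) {n : ℕ} (d : Fin n → R) : Fin n → S :=
  fun i => f (d i)

/-- The Pfister form `⟨1,a 0⟩ ⊗ ⋯ ⊗ ⟨1, a (n-1)⟩`: its `2^n` diagonal coefficients are
the products `∏_{j ∈ S} a j` over subsets `S` of the index set. -/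
noncomputable def pfisterOf {n : ℕ} (a : Fin n → R) : Fin (2 ^ n) → R :=
  fun i => ∏ j : Fin n, if (finFunctionFinEquiv.symm i) j = 0 then 1 else a j

/-- `π` is an `n`-fold Pfister form. -/
def IsNPfister (n : ℕ) {m : ℕ} (π : Fin m → R) : Prop :=
  ∃ a : Fin n → R, (∀ i, a i ≠ 0) ∧ Isometric π (pfisterOf a)

/-- `π` is a Pfister form. -/
def IsPfister {m : ℕ} (π : Fin m → R) : Prop := ∃ n : ℕ, IsNPfister n π

end Defs

/-- The quadric polynomial `p(X₁,…,Xₙ) = ∑ dᵢ Xᵢ²` attached to a diagonal form. -/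
noncomputable def formPoly {F : Type*} [CommRing F] {n : ℕ} (d : Fin n → F) :
    MvPolynomial (Fin n) F :=
  ∑ i, MvPolynomial.C (d i) * MvPolynomial.X i ^ 2

/-- The affine coordinate ring `F[X₁,…,Xₙ]/(p(X))` of the quadric `p = 0`. -/
abbrev CoordRing {F : Type*} [CommRing F] {n : ℕ} (d : Fin n → F) : Type _ :=
  MvPolynomial (Fin n) F ⧸ Ideal.span {formPoly d}

/-- The function field `F(p)` of the quadric `p = 0`: the total fraction ring of the
coordinate ring (the quotient field when the coordinate ring is a domain, i.e. when `p` is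
anisotropic of dimension at least 2). -/
abbrev FunField {F : Type*} [Field F] {n : ℕ} (d : Fin n → F) : Type _ :=
  FractionRing (CoordRing d)

end QF


namespace QF

open Matrix Kronecker

section QuadraticAlgebra

variable {R ι κ κ' : Type*} [CommRing R] [Fintype ι]

theorem quadraticAlgebra_map_re_mul {x : R} (A : Matrix κ ι (QuadraticAlgebra R x 0))
    (B : Matrix ι κ' (QuadraticAlgebra R x 0)) :
    (A * B).map QuadraticAlgebra.re = A.map QuadraticAlgebra.re * B.map QuadraticAlgebra.re +
      x • (A.map QuadraticAlgebra.im * B.map QuadraticAlgebra.im) := by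
  ext i j
  have hsum := map_sum ((LinearMap.proj 0).comp
    (QuadraticAlgebra.linearEquivTuple x (0 : R)).toLinearMap)
    (fun l => A i l * B l j) Finset.univ
  simp only [LinearMap.comp_apply, LinearMap.proj_apply, LinearEquiv.coe_coe,
    QuadraticAlgebra.linearEquivTuple_apply, Matrix.cons_val_zero] at hsum
  simp only [Matrix.map_apply, Matrix.mul_apply, Matrix.add_apply, Matrix.smul_apply,
    smul_eq_mul, Finset.mul_sum, hsum, QuadraticAlgebra.re_mul, ← Finset.sum_add_distrib]
  exact Finset.sum_congr rfl fun _ _ => by ring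

theorem quadraticAlgebra_map_im_mul {x : R} (A : Matrix κ ι (QuadraticAlgebra R x 0))
    (B : Matrix ι κ' (QuadraticAlgebra R x 0)) :
    (A * B).map QuadraticAlgebra.im = A.map QuadraticAlgebra.re * B.map QuadraticAlgebra.im +
      A.map QuadraticAlgebra.im * B.map QuadraticAlgebra.re := by
  ext i j
  have hsum := map_sum ((LinearMap.proj 1).comp
    (QuadraticAlgebra.linearEquivTuple x (0 : R)).toLinearMap)
    (fun l => A i l * B l j) Finset.univ
  simp only [LinearMap.comp_apply, LinearMap.proj_apply, LinearEquiv.coe_coe,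
    QuadraticAlgebra.linearEquivTuple_apply, Matrix.cons_val_one, Matrix.cons_val_fin_one] at hsum
  simp only [Matrix.map_apply, Matrix.mul_apply, Matrix.add_apply, hsum,
    QuadraticAlgebra.im_mul, ← Finset.sum_add_distrib]
  exact Finset.sum_congr rfl fun _ _ => by ring

end QuadraticAlgebra

section TotallyIsotropic

variable {R : Type*} [CommRing R] {ι ι' κ κ' β : Type*} [Fintype ι] [Fintype ι'] [Fintype κ]
  [Fintype κ'] [Fintype β] [DecidableEq ι] [DecidableEq ι'] [DecidableEq κ] [DecidableEq κ']
  [DecidableEq β]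

/-- The diagonal form `d` over `R` has a totally isotropic direct summand with basis indexed by
`κ`: the columns of `U` form the basis, and `V` provides a retraction. -/
def HasTotIso (d : ι → R) (κ : Type*) [Fintype κ] [DecidableEq κ] : Prop :=
  ∃ (U : Matrix ι κ R) (V : Matrix κ ι R), V * U = 1 ∧ Uᵀ * diagonal d * U = 0

theorem HasTotIso.map {S : Type*} [CommRing S] (f : R →+* S) {d : ι → R} (h : HasTotIso d κ) :
    HasTotIso (fun i => f (d i)) κ := by
  obtain ⟨U, V, h1, h2⟩ := h
  refine ⟨U.map f, V.map f, ?_, ?_⟩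
  · rw [← Matrix.map_mul, h1, Matrix.map_one _ f.map_zero f.map_one]
  · have := congrArg (fun A => A.map f) h2
    simpa [Matrix.map_mul, Matrix.transpose_map, Matrix.diagonal_map, Function.comp_def]
      using this

theorem HasTotIso.of_embedding {d : ι → R} (h : HasTotIso d κ) (e : κ' ↪ κ) :
    HasTotIso d κ' := by
  obtain ⟨U, V, h1, h2⟩ := h
  refine ⟨U.submatrix id e, V.submatrix e id, ?_, ?_⟩
  · rw [← Matrix.submatrix_mul V U e id e Function.bijective_id, h1,
      Matrix.submatrix_one _ e.injective]
  · have h3 : (Uᵀ * diagonal d * U).submatrix e e = 0 := by rw [h2]; rfl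
    rw [Matrix.submatrix_mul _ U e id e Function.bijective_id,
      Matrix.submatrix_mul _ (diagonal d) e id id Function.bijective_id] at h3
    simpa using h3

theorem HasTotIso.reindex {d : ι → R} (h : HasTotIso d κ) (e : ι' ≃ ι) :
    HasTotIso (fun i => d (e i)) κ := by
  obtain ⟨U, V, h1, h2⟩ := h
  refine ⟨U.submatrix e id, V.submatrix id e, ?_, ?_⟩
  · rw [← Matrix.submatrix_mul V U id e id e.bijective, h1, Matrix.submatrix_id_id]
  · have h3 : diagonal (fun i => d (e i)) = (diagonal d).submatrix e e := by
      rw [Matrix.submatrix_diagonal_equiv]; rfl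
    rw [h3, Matrix.transpose_submatrix, ← Matrix.submatrix_mul _ _ id e e e.bijective,
      ← Matrix.submatrix_mul _ _ id e id e.bijective, h2]
    rfl

/-- Totally isotropic summands can be pulled back along a congruence of Gram matrices. -/
theorem HasTotIso.congr {d : ι → R} {e : ι' → R} {M : Matrix ι' ι R} {N : Matrix ι ι' R}
    (hMN : M * N = 1) (hG : Mᵀ * diagonal e * M = diagonal d) (h : HasTotIso e κ) :
    HasTotIso d κ := by
  obtain ⟨U, V, h1, h2⟩ := h
  refine ⟨N * U, V * M, ?_, ?_⟩
  · rw [Matrix.mul_assoc, ← Matrix.mul_assoc M, hMN, Matrix.one_mul, h1]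
  · have : Nᵀ * diagonal d * N = diagonal e := by
      rw [← hG]
      calc Nᵀ * (Mᵀ * diagonal e * M) * N = (M * N)ᵀ * diagonal e * (M * N) := by
            simp only [Matrix.transpose_mul, Matrix.mul_assoc]
        _ = _ := by simp [hMN]
    calc (N * U)ᵀ * diagonal d * (N * U) = Uᵀ * (Nᵀ * diagonal d * N) * U := by
          simp only [Matrix.transpose_mul, Matrix.mul_assoc]
      _ = 0 := by rw [this, h2]

/-- The tensor product of diagonal forms on the product of the index types. -/
def tprod (e : β → R) (d : ι → R) : β × ι → R := fun x => e x.1 * d x.2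

theorem diagonal_tprod {ι β : Type*} [DecidableEq ι] [DecidableEq β] (e : β → R) (d : ι → R) :
    diagonal (tprod e d) = diagonal e ⊗ₖ diagonal d := by
  rw [diagonal_kronecker_diagonal]; rfl

theorem HasTotIso.tprod_left (e : β → R) {d : ι → R} (h : HasTotIso d κ) :
    HasTotIso (tprod e d) (β × κ) := by
  obtain ⟨U, V, h1, h2⟩ := h
  refine ⟨1 ⊗ₖ U, 1 ⊗ₖ V, ?_, ?_⟩
  · rw [← mul_kronecker_mul, h1, Matrix.one_mul, one_kronecker_one]
  · rw [diagonal_tprod, show (1 ⊗ₖ U : Matrix (β × ι) (β × κ) R)ᵀ = 1ᵀ ⊗ₖ Uᵀ from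
      (kroneckerMap_transpose _ _ _).symm, ← mul_kronecker_mul, ← mul_kronecker_mul, h2,
      kronecker_zero]

theorem HasTotIso.tprod_right (d : ι → R) {e : β → R} (h : HasTotIso e κ) :
    HasTotIso (tprod e d) (κ × ι) := by
  obtain ⟨U, V, h1, h2⟩ := h
  refine ⟨U ⊗ₖ 1, V ⊗ₖ 1, ?_, ?_⟩
  · rw [← mul_kronecker_mul, h1, Matrix.one_mul, one_kronecker_one]
  · rw [diagonal_tprod, show (U ⊗ₖ 1 : Matrix (β × ι) (κ × ι) R)ᵀ = Uᵀ ⊗ₖ 1ᵀ from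
      (kroneckerMap_transpose _ _ _).symm, ← mul_kronecker_mul, ← mul_kronecker_mul, h2,
      zero_kronecker]

/-- A totally isotropic summand of rank `k` over `R[√x]` yields one of rank `2k` over `R` after
tensoring with a binary form admitting a self-adjoint endomorphism `S` with `S² = x`. -/
theorem HasTotIso.transfer {x : R} {d : ι → R} (e : β → R) (S : Matrix β β R)
    (hS : S * S = x • (1 : Matrix β β R)) (hadj : Sᵀ * diagonal e = diagonal e * S)
    (h : HasTotIso (fun i => algebraMap R (QuadraticAlgebra R x 0) (d i)) κ) :
    HasTotIso (tprod e d) (β × κ) := by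
  obtain ⟨U, V, h1, h2⟩ := h
  set A : Matrix ι κ R := U.map QuadraticAlgebra.re
  set B : Matrix ι κ R := U.map QuadraticAlgebra.im
  set C : Matrix κ ι R := V.map QuadraticAlgebra.re
  set E : Matrix κ ι R := V.map QuadraticAlgebra.im
  have r1 := congrArg (fun M => M.map QuadraticAlgebra.re) h1
  have i1 := congrArg (fun M => M.map QuadraticAlgebra.im) h1
  have r2 := congrArg (fun M => M.map QuadraticAlgebra.re) h2
  have i2 := congrArg (fun M => M.map QuadraticAlgebra.im) h2
  have hone : (1 : Matrix κ κ (QuadraticAlgebra R x 0)).map QuadraticAlgebra.re = 1 :=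
    Matrix.map_one _ rfl rfl
  have hone' : (1 : Matrix κ κ (QuadraticAlgebra R x 0)).map QuadraticAlgebra.im = 0 := by
    ext i j
    rw [Matrix.map_apply, Matrix.one_apply]
    split_ifs <;> rfl
  have hzero : (0 : Matrix κ κ (QuadraticAlgebra R x 0)).map QuadraticAlgebra.re = 0 := rfl
  have hzero' : (0 : Matrix κ κ (QuadraticAlgebra R x 0)).map QuadraticAlgebra.im = 0 := rfl
  have hdr : (diagonal fun i => algebraMap R (QuadraticAlgebra R x 0) (d i)).map
      QuadraticAlgebra.re = diagonal d := by
    ext i j; by_cases h : i = j <;> simp [h]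
  have hdi : (diagonal fun i => algebraMap R (QuadraticAlgebra R x 0) (d i)).map
      QuadraticAlgebra.im = 0 := by
    ext i j; by_cases h : i = j <;> simp [h]
  simp only [quadraticAlgebra_map_re_mul, quadraticAlgebra_map_im_mul, hone, hone', hzero, hzero',
    hdr, hdi, Matrix.mul_zero, smul_zero, add_zero, zero_add]
    at r1 i1 r2 i2
  have r1' : C * A + x • (E * B) = 1 := r1
  have i1' : C * B + E * A = 0 := i1
  have r2' : Aᵀ * diagonal d * A + x • (Bᵀ * diagonal d * B) = 0 := r2
  have i2' : Aᵀ * diagonal d * B + Bᵀ * diagonal d * A = 0 := i2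
  refine ⟨1 ⊗ₖ A + S ⊗ₖ B, 1 ⊗ₖ C + S ⊗ₖ E, ?_, ?_⟩
  · have : (1 ⊗ₖ C + S ⊗ₖ E) * (1 ⊗ₖ A + S ⊗ₖ B) =
        (1 : Matrix β β R) ⊗ₖ (C * A + x • (E * B)) + S ⊗ₖ (C * B + E * A) := by
      simp only [Matrix.mul_add, Matrix.add_mul, ← mul_kronecker_mul, hS, Matrix.one_mul,
        Matrix.mul_one, kronecker_add, smul_kronecker, kronecker_smul]
      abel
    rw [this, r1', i1', kronecker_zero, add_zero, one_kronecker_one]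
  · have hT : ((1 : Matrix β β R) ⊗ₖ A + S ⊗ₖ B)ᵀ = (1 : Matrix β β R) ⊗ₖ Aᵀ + Sᵀ ⊗ₖ Bᵀ := by
      rw [Matrix.transpose_add]
      nth_rw 2 [← Matrix.transpose_one]
      exact congrArg₂ (· + ·) (kroneckerMap_transpose _ _ _).symm
        (kroneckerMap_transpose _ _ _).symm
    have : (1 ⊗ₖ Aᵀ + Sᵀ ⊗ₖ Bᵀ) * (diagonal e ⊗ₖ diagonal d) * (1 ⊗ₖ A + S ⊗ₖ B) =
        diagonal e ⊗ₖ (Aᵀ * diagonal d * A + x • (Bᵀ * diagonal d * B)) +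
        (diagonal e * S) ⊗ₖ (Aᵀ * diagonal d * B + Bᵀ * diagonal d * A) := by
      simp only [Matrix.mul_add, Matrix.add_mul, ← mul_kronecker_mul, hadj, Matrix.one_mul,
        Matrix.mul_one, kronecker_add, Matrix.mul_assoc (diagonal e) S S, hS, Matrix.mul_smul,
        smul_kronecker, kronecker_smul]
      abel
    rw [hT, diagonal_tprod, this, r2', i2', kronecker_zero, kronecker_zero, add_zero]

end TotallyIsotropic
end QF

namespace QF

open Matrix Kronecker

universe u v

section Forcing

variable {ι ι' κ : Type*} [Fintype ι] [Fintype ι'] [Fintype κ]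
  [DecidableEq ι'] [DecidableEq κ]

/-- The diagonal form `d` has a nontrivial zero. -/
def HasZero {R : Type*} [CommRing R] (d : ι → R) : Prop :=
  ∃ v : ι → R, v ≠ 0 ∧ ∑ i, d i * v i ^ 2 = 0

theorem HasZero.reindex {ι ι' : Type*} [Fintype ι] [Fintype ι'] {R : Type*} [CommRing R] {d : ι → R} (h : HasZero d) (e : ι' ≃ ι) :
    HasZero (fun i => d (e i)) := by
  obtain ⟨v, h0, hv⟩ := h
  refine ⟨fun i => v (e i), fun h => h0 ?_, ?_⟩
  · funext i
    simpa using congrFun h (e.symm i)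
  · rw [← hv]
    exact e.sum_comp fun i => d i * v i ^ 2

/-- Over every field extension over which `p` is isotropic, the form `q` has a totally isotropic
subspace with basis indexed by `κ`. -/
def ForcesTotIso {F : Type u} [Field F] (p : ι → F) (q : ι' → F) (κ : Type*) [Fintype κ]
    [DecidableEq κ] : Prop :=
  ∀ (L : Type v) [Field L] (f : F →+* L), HasZero (fun i => f (p i)) →
    HasTotIso (fun i => f (q i)) κ

/-- If `-a` is a square then `⟨1,a⟩ ⊗ q` is hyperbolic. -/
theorem hasTotIso_tprod_of_sq {K : Type*} [Field K] {a c : K} (hc : c ^ 2 = -a) (q : ι' → K) :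
    HasTotIso (tprod ![1, a] q) (Fin 1 × ι') := by
  refine HasTotIso.tprod_right q ⟨!![c; 1], !![0, 1], ?_, ?_⟩
  · ext i j; fin_cases i; fin_cases j; simp
  · ext i j
    fin_cases i; fin_cases j
    simp [Matrix.mul_apply, Fin.sum_univ_two]
    linear_combination hc

theorem ForcesTotIso.tprod_binary_aux {K : Type v} [Field K] {p : ι → K} {q : ι' → K}
    (H : ForcesTotIso.{v, v} p q κ) (hκ : 2 * Fintype.card κ ≤ Fintype.card ι') {a : K}
    (hz : HasZero (tprod ![1, a] p)) :
    HasTotIso (tprod ![1, a] q) (Fin 2 × κ) := by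
  by_cases hp : HasZero p
  · exact (H K (RingHom.id K) hp).tprod_left _
  have aniso : ∀ v : ι → K, ∑ i, p i * v i ^ 2 = 0 → v = 0 := fun v hv => by
    by_contra h; exact hp ⟨v, h, hv⟩
  by_cases hsq : ∃ c : K, c ^ 2 = -a
  · obtain ⟨c, hc⟩ := hsq
    refine (hasTotIso_tprod_of_sq hc q).of_embedding
      (Function.Embedding.nonempty_of_card_le ?_).some
    simpa using hκ
  obtain ⟨w, hw0, hw⟩ := hz
  rw [Fintype.sum_prod_type, Fin.sum_univ_two] at hw
  simp only [tprod, Matrix.cons_val_zero, Matrix.cons_val_one, Matrix.cons_val_fin_one,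
    one_mul] at hw
  set u : ι → K := fun i => w (0, i)
  set v : ι → K := fun i => w (1, i)
  have hw' : ∑ i, p i * u i ^ 2 + a * ∑ i, p i * v i ^ 2 = 0 := by
    rw [← hw, Finset.mul_sum]
    congr 1
    exact Finset.sum_congr rfl fun _ _ => by ring
  have hv : ∑ i, p i * v i ^ 2 ≠ 0 := by
    intro hv
    rw [hv, mul_zero, add_zero] at hw'
    have hu := aniso u hw'
    have hv := aniso v hv
    apply hw0
    funext ⟨b, i⟩
    fin_cases b
    · exact congrFun hu i
    · exact congrFun hv i
  set s := ∑ i, p i * v i ^ 2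
  set t := ∑ i, p i * (u i * v i)
  set c := t / s with hc
  have hct : c * s = t := div_mul_cancel₀ _ hv
  set x := c ^ 2 + a with hx
  have key : ∑ i, p i * (u i - c * v i) ^ 2 + x * s = 0 := by
    have : ∑ i, p i * (u i - c * v i) ^ 2 =
        ∑ i, p i * u i ^ 2 - 2 * c * t + c ^ 2 * s := by
      simp only [s, t, Finset.mul_sum, ← Finset.sum_add_distrib, ← Finset.sum_sub_distrib]
      exact Finset.sum_congr rfl fun _ _ => by ring
    rw [this, hx]
    linear_combination hw' + 2 * c * hct
  have horth : ∑ i, p i * ((u i - c * v i) * v i) = 0 := by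
    have : ∑ i, p i * ((u i - c * v i) * v i) = t - c * s := by
      simp only [s, t, Finset.mul_sum, ← Finset.sum_sub_distrib]
      exact Finset.sum_congr rfl fun _ _ => by ring
    rw [this, hct, sub_self]
  have hnsq : ∀ r : K, r ^ 2 ≠ x + 0 * r := by
    intro r hr
    rw [zero_mul, add_zero] at hr
    have h0 : ∑ i, p i * ((u i - c * v i) + r * v i) ^ 2 = 0 := by
      have : ∑ i, p i * ((u i - c * v i) + r * v i) ^ 2 =
          ∑ i, p i * (u i - c * v i) ^ 2 + 2 * r * ∑ i, p i * ((u i - c * v i) * v i)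
            + r ^ 2 * s := by
        simp only [s, Finset.mul_sum, ← Finset.sum_add_distrib]
        exact Finset.sum_congr rfl fun _ _ => by ring
      rw [this, horth, hr]
      linear_combination key
    have h1 := aniso _ h0
    have h2 : r * s = 0 := by
      have : ∑ i, p i * (((u i - c * v i) + r * v i) * v i) = 0 := by
        refine Finset.sum_eq_zero fun i _ => ?_
        rw [show (u i - c * v i) + r * v i = 0 from congrFun h1 i]; ring
      rw [← this]
      have : ∑ i, p i * (((u i - c * v i) + r * v i) * v i) =
          ∑ i, p i * ((u i - c * v i) * v i) + r * s := by
        simp only [s, Finset.mul_sum, ← Finset.sum_add_distrib]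
        exact Finset.sum_congr rfl fun _ _ => by ring
      rw [this, horth, zero_add]
    have hr0 : r = 0 := (mul_eq_zero.mp h2).resolve_right hv
    refine hsq ⟨c, ?_⟩
    rw [hr0] at hr
    linear_combination -hr - hx
  have : Fact (∀ r : K, r ^ 2 ≠ x + 0 * r) := ⟨hnsq⟩
  have hT := H (QuadraticAlgebra K x 0) (algebraMap K _) ?_
  · refine HasTotIso.transfer ![1, a] !![c, a; 1, -c] ?_ ?_ hT
    · ext i j
      fin_cases i <;> fin_cases j <;> simp [Matrix.mul_apply, Fin.sum_univ_two, hx] <;> ring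
    · ext i j
      fin_cases i <;> fin_cases j <;> simp [Matrix.mul_apply, Fin.sum_univ_two] <;> ring
  · refine ⟨fun i => ⟨u i - c * v i, v i⟩, fun h => hv ?_, ?_⟩
    · refine Finset.sum_eq_zero fun i _ => ?_
      have : v i = 0 := congrArg QuadraticAlgebra.im (congrFun h i)
      rw [this]; ring
    · have h1 : ∀ i, algebraMap K (QuadraticAlgebra K x 0) (p i) *
          (⟨u i - c * v i, v i⟩ : QuadraticAlgebra K x 0) ^ 2 =
          algebraMap K _ (p i * (u i - c * v i) ^ 2 + x * (p i * v i ^ 2)) +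
          algebraMap K _ (2 * (p i * ((u i - c * v i) * v i))) * ⟨0, 1⟩ := by
        intro i
        ext <;> simp [pow_two] <;> ring
      rw [Finset.sum_congr rfl fun i _ => h1 i, Finset.sum_add_distrib, ← Finset.sum_mul,
        ← map_sum, ← map_sum, Finset.sum_add_distrib, ← Finset.mul_sum, ← Finset.mul_sum, key,
        horth]
      simp

theorem ForcesTotIso.tprod_binary {F : Type u} [Field F] {p : ι → F} {q : ι' → F}
    (H : ForcesTotIso.{u, v} p q κ) (hκ : 2 * Fintype.card κ ≤ Fintype.card ι') (a : F) :
    ForcesTotIso.{u, v} (tprod ![1, a] p) (tprod ![1, a] q) (Fin 2 × κ) := by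
  intro K _ f hz
  have hf : ∀ {ι : Type _} (d : ι → F), (fun x => f (tprod ![1, a] d x)) =
      tprod ![1, f a] (fun i => f (d i)) := by
    intro ι d
    funext ⟨b, i⟩
    fin_cases b <;> simp [tprod]
  have h2 : (fun x => f (tprod ![1, a] q x)) = tprod ![1, f a] (fun i => f (q i)) := by
    funext ⟨b, i⟩
    fin_cases b <;> simp [tprod]
  rw [hf] at hz
  rw [h2]
  exact ForcesTotIso.tprod_binary_aux (fun L _ g => H L (g.comp f)) hκ
    hz

/-- The coefficients of the Pfister form with slots `a`, indexed by functions `Fin n → Fin 2`. -/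
def pfisterCoeff {R : Type*} [CommRing R] {n : ℕ} (a : Fin n → R) (g : Fin n → Fin 2) : R :=
  ∏ j, if g j = 0 then 1 else a j

/-- Splitting off the first slot of a Pfister form. -/
def consProdEquiv (n : ℕ) (α : Type*) :
    (Fin (n + 1) → Fin 2) × α ≃ Fin 2 × (Fin n → Fin 2) × α :=
  ((Fin.consEquiv fun _ => Fin 2).symm.prodCongr (Equiv.refl α)).trans (Equiv.prodAssoc _ _ _)

theorem tprod_pfisterCoeff_consProdEquiv {R α : Type*} [CommRing R] {n : ℕ} (a : Fin (n + 1) → R)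
    (d : α → R) (x : (Fin (n + 1) → Fin 2) × α) :
    tprod ![1, a 0] (tprod (pfisterCoeff fun i => a i.succ) d) (consProdEquiv n α x) =
      tprod (pfisterCoeff a) d x := by
  obtain ⟨g, y⟩ := x
  have h2 : ∀ b : Fin 2, (![1, a 0] : Fin 2 → R) b = if b = 0 then 1 else a 0 := by
    intro b; fin_cases b <;> rfl
  simp only [tprod, pfisterCoeff, Fin.prod_univ_succ, h2]
  rw [mul_assoc]
  rfl

theorem ForcesTotIso.tprod_pfister {F : Type u} [Field F] {n : ℕ} (a : Fin n → F)
    {p : ι → F} {q : ι' → F} (H : ForcesTotIso.{u, v} p q κ)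
    (hκ : 2 * Fintype.card κ ≤ Fintype.card ι') :
    ForcesTotIso.{u, v} (tprod (pfisterCoeff a) p) (tprod (pfisterCoeff a) q)
      ((Fin n → Fin 2) × κ) := by
  induction n with
  | zero =>
    intro L _ f hz
    have h1 := hz.reindex (Equiv.uniqueProd ι (Fin 0 → Fin 2)).symm
    have h2 := H L f (by simpa [tprod, pfisterCoeff] using h1)
    have h3 := (h2.reindex (Equiv.uniqueProd ι' (Fin 0 → Fin 2))).of_embedding
      (Equiv.uniqueProd κ (Fin 0 → Fin 2)).toEmbedding
    simpa [tprod, pfisterCoeff] using h3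
  | succ n ih =>
    have h1 := (ih fun i => a i.succ).tprod_binary (by
      simp only [Fintype.card_prod, mul_left_comm 2]
      exact Nat.mul_le_mul_left _ hκ) (a 0)
    intro L _ f hz
    have hz' := hz.reindex (consProdEquiv n ι).symm
    simp only [← tprod_pfisterCoeff_consProdEquiv, Equiv.apply_symm_apply] at hz'
    have h2 := ((h1 L f hz').reindex (consProdEquiv n ι')).of_embedding
      (consProdEquiv n κ).toEmbedding
    simpa only [tprod_pfisterCoeff_consProdEquiv] using h2

end Forcing
end QF

namespace QF

open Matrix

section Isometry

variable {R : Type*} [CommRing R] {m n : ℕ}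

theorem evalQF_add (d : Fin n → R) (u v : Fin n → R) :
    evalQF d (u + v) = evalQF d u + evalQF d v + 2 * ∑ i, d i * (u i * v i) := by
  simp only [evalQF, Finset.mul_sum, ← Finset.sum_add_distrib, Pi.add_apply]
  exact Finset.sum_congr rfl fun _ _ => by ring

/-- An isometry of diagonal forms is a congruence of their Gram matrices. -/
theorem Isometric.exists_matrix (h2 : IsUnit (2 : R)) {d : Fin m → R} {e : Fin n → R}
    (h : Isometric d e) : ∃ (M : Matrix (Fin n) (Fin m) R) (N : Matrix (Fin m) (Fin n) R),
      M * N = 1 ∧ N * M = 1 ∧ Mᵀ * diagonal e * M = diagonal d := by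
  obtain ⟨φ, hφ⟩ := h
  refine ⟨LinearMap.toMatrix' φ.toLinearMap, LinearMap.toMatrix' φ.symm.toLinearMap, ?_, ?_, ?_⟩
  · rw [← LinearMap.toMatrix'_comp]; simp
  · rw [← LinearMap.toMatrix'_comp]; simp
  have hb : ∀ u v, ∑ i, e i * (φ u i * φ v i) = ∑ i, d i * (u i * v i) := by
    intro u v
    apply h2.mul_left_cancel
    have h3 := hφ (u + v)
    rw [map_add, evalQF_add, evalQF_add, hφ, hφ] at h3
    exact add_left_cancel h3
  ext i j
  have h3 := hb (Pi.single i 1) (Pi.single j 1)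
  rw [Matrix.mul_apply]
  simp only [Matrix.mul_diagonal, Matrix.transpose_apply, LinearMap.toMatrix'_apply]
  calc _ = ∑ l, e l * (φ (Pi.single i 1) l * φ (Pi.single j 1) l) :=
        Finset.sum_congr rfl fun _ _ => by
          simp only [LinearEquiv.coe_coe]
          ring
    _ = _ := by
      rw [h3]
      rcases eq_or_ne i j with rfl | hij
      · simp [Pi.single_apply]
      · simp [Pi.single_apply, hij, hij.symm]

theorem Isometric.card_eq [Nontrivial R] {d : Fin m → R} {e : Fin n → R} (h : Isometric d e) :
    m = n := by
  obtain ⟨φ, -⟩ := h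
  simpa using φ.finrank_eq

theorem hasTotIso_osum_hypform (k : ℕ) (r : Fin m → R) :
    HasTotIso (osum (hypform k) r) (Fin k) := by
  let a (i : Fin k) : Fin (k + k + m) := Fin.castAdd m (Fin.castAdd k i)
  let b (i : Fin k) : Fin (k + k + m) := Fin.castAdd m (Fin.natAdd k i)
  have hab : ∀ i j, a i ≠ b j := by
    intro i j h
    have := congrArg Fin.val h
    simp [a, b] at this
    omega
  have ha : ∀ i j, a i = a j ↔ i = j := by simp [a]
  have hb : ∀ i j, b i = b j ↔ i = j := by simp [b]
  have hda : ∀ i, osum (hypform k) r (a i) = 1 := by simp [osum, hypform, a]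
  have hdb : ∀ i, osum (hypform k) r (b i) = -1 := fun i => by
    simp only [osum, hypform, b, Fin.append_left, Fin.append_right]
  have hs : ∀ (f : Fin (k + k + m) → R) (i : Fin k),
      ∑ l, f l * ((if l = a i then 1 else 0) + if l = b i then 1 else 0) = f (a i) + f (b i) := by
    intro f i
    simp [mul_add, Finset.sum_add_distrib]
  refine ⟨Matrix.of fun l i => (if l = a i then 1 else 0) + if l = b i then 1 else 0,
    Matrix.of fun i l => if l = a i then 1 else 0, ?_, ?_⟩
  · ext i j
    simp only [Matrix.mul_apply, Matrix.of_apply, hs, Matrix.one_apply, ha, (hab _ _).symm,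
      if_false, add_zero, eq_comm]
  · ext i j
    rw [Matrix.mul_apply]
    simp only [Matrix.of_apply, hs, Matrix.mul_diagonal, Matrix.transpose_apply,
      hda, hdb, ha, hb, hab, (hab _ _).symm, if_false, add_zero, zero_add, Matrix.zero_apply]
    rcases eq_or_ne i j with rfl | hij
    · simp
    · simp [hij.symm]

theorem Isometric.hasTotIso (h2 : IsUnit (2 : R)) {k : ℕ} {d : Fin n → R} {r : Fin m → R}
    (h : Isometric d (osum (hypform k) r)) : HasTotIso d (Fin k) := by
  obtain ⟨M, N, hMN, -, hG⟩ := h.exists_matrix h2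
  exact (hasTotIso_osum_hypform k r).congr hMN hG

theorem bddAbove_wittIndex [Nontrivial R] (d : Fin n → R) :
    BddAbove {k : ℕ | ∃ (m : ℕ) (r : Fin m → R), Isometric d (osum (hypform k) r)} := by
  refine ⟨n, ?_⟩
  rintro k ⟨m, r, h⟩
  have := h.card_eq
  omega

theorem hasTotIso_wittIndex [Nontrivial R] (h2 : IsUnit (2 : R)) (d : Fin n → R) :
    HasTotIso d (Fin (WittIndex d)) ∧ 2 * WittIndex d ≤ n := by
  rcases Set.eq_empty_or_nonempty
    {k : ℕ | ∃ (m : ℕ) (r : Fin m → R), Isometric d (osum (hypform k) r)} with h | h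
  · have h0 : WittIndex d = 0 := by rw [WittIndex, h, csSup_empty, Nat.bot_eq_zero]
    rw [h0]
    exact ⟨⟨0, 0, Subsingleton.elim _ _, Subsingleton.elim _ _⟩, by simp⟩
  · obtain ⟨m, r, hr⟩ := Nat.sSup_mem h (bddAbove_wittIndex d)
    refine ⟨hr.hasTotIso h2, ?_⟩
    have := hr.card_eq
    rw [WittIndex]
    omega

end Isometry

section Field

variable {K : Type*} [Field K] {n : ℕ}

theorem exists_basis_apply_eq_zero (h2 : (2 : K) ≠ 0) {V : Type*} [AddCommGroup V] [Module K V]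
    [FiniteDimensional K V] (B : LinearMap.BilinForm K V) (hB : ∀ u v, B u v = B v u) :
    ∃ (m : ℕ) (w : Module.Basis (Fin m) K V), ∀ i j, i ≠ j → B (w i) (w j) = 0 := by
  have : Invertible (2 : K) := invertibleOfNonzero h2
  obtain ⟨w, hw⟩ := LinearMap.BilinForm.exists_orthogonal_basis (B := B) ⟨hB⟩
  exact ⟨_, w, fun _ _ hij => hw hij⟩

/-- A subspace with nondegenerate diagonal Gram matrix splits off orthogonally. -/
theorem exists_isometric_osum_of_gram (h2 : (2 : K) ≠ 0) {l : ℕ} {d : Fin n → K} {e : Fin l → K}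
    (he : Nondeg e) {P : Matrix (Fin n) (Fin l) K} (hP : Pᵀ * diagonal d * P = diagonal e) :
    ∃ (m : ℕ) (r : Fin m → K), Isometric d (osum e r) := by
  let B : LinearMap.BilinForm K (Fin n → K) := Matrix.toBilin' (diagonal d)
  let T : (Fin n → K) →ₗ[K] (Fin l → K) := (Pᵀ * diagonal d).mulVecLin
  let W := LinearMap.ker T
  have hB : ∀ u v, B u v = ∑ i, d i * (u i * v i) := by
    intro u v
    simp only [B, Matrix.toBilin'_apply', Matrix.mulVec_diagonal, dotProduct]
    exact Finset.sum_congr rfl fun _ _ => by ring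
  have hsymm : ∀ u v, B u v = B v u := fun u v => by
    rw [hB, hB]
    exact Finset.sum_congr rfl fun _ _ => by ring
  obtain ⟨m, w, hw⟩ : ∃ (m : ℕ) (w : Module.Basis (Fin m) K W),
      ∀ i j, i ≠ j → B (w i) (w j) = 0 :=
    exists_basis_apply_eq_zero h2 (B.restrict W) fun u v => hsymm u v
  have hTP : ∀ c, T (P *ᵥ c) = fun i => e i * c i := by
    intro c
    simp only [T, Matrix.mulVecLin_apply, Matrix.mulVec_mulVec, hP]
    funext i
    simp [Matrix.mulVec_diagonal]
  have hPB : ∀ c v, B (P *ᵥ c) v = ∑ i, c i * T v i := by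
    intro c v
    simp only [B, T, Matrix.toBilin'_apply', Matrix.mulVecLin_apply]
    rw [dotProduct_comm, Matrix.dotProduct_mulVec, ← Matrix.mulVec_transpose,
      Matrix.mulVec_mulVec, dotProduct_comm]
    rfl
  let Φ : (Fin (l + m) → K) →ₗ[K] (Fin n → K) :=
    P.mulVecLin ∘ₗ LinearMap.funLeft K K (Fin.castAdd m) +
      W.subtype ∘ₗ w.equivFun.symm.toLinearMap ∘ₗ LinearMap.funLeft K K (Fin.natAdd l)
  have hΦ : ∀ c, Φ c = P *ᵥ (fun i => c (Fin.castAdd m i)) +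
    (w.equivFun.symm (fun j => c (Fin.natAdd l j)) : Fin n → K) := fun c => rfl
  have hinj : Function.Injective Φ := by
    rw [← LinearMap.ker_eq_bot, LinearMap.ker_eq_bot']
    intro c hc
    have h1 : ∀ i, c (Fin.castAdd m i) = 0 := by
      have h3 := congrArg T hc
      rw [hΦ, map_add, LinearMap.mem_ker.mp (w.equivFun.symm _).2, add_zero, hTP, map_zero] at h3
      intro i
      exact (mul_eq_zero.mp (congrFun h3 i)).resolve_left (he i)
    have h3 : (fun j => c (Fin.natAdd l j)) = 0 := by
      rw [hΦ, show (fun i => c (Fin.castAdd m i)) = 0 from funext h1, Matrix.mulVec_zero,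
        zero_add] at hc
      exact (w.equivFun.symm.map_eq_zero_iff).mp (Subtype.ext hc)
    funext i
    refine Fin.addCases h1 (fun j => congrFun h3 j) i
  have hsurj : Function.Surjective Φ := by
    intro v
    let c : Fin l → K := fun i => T v i / e i
    have hmem : v - P *ᵥ c ∈ W := by
      rw [LinearMap.mem_ker, map_sub, hTP, sub_eq_zero]
      funext i
      exact (mul_div_cancel₀ _ (he i)).symm
    refine ⟨Fin.append c (w.equivFun ⟨_, hmem⟩), ?_⟩
    rw [hΦ]
    simp
  refine ⟨m, fun j => B (w j) (w j), (LinearEquiv.ofBijective Φ ⟨hinj, hsurj⟩).symm, fun v => ?_⟩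
  obtain ⟨c, rfl⟩ := hsurj v
  have h3 : (LinearEquiv.ofBijective Φ ⟨hinj, hsurj⟩).symm (Φ c) = c :=
    (LinearEquiv.ofBijective Φ ⟨hinj, hsurj⟩).symm_apply_apply c
  rw [h3]
  have h4 : ∀ v, evalQF d v = B v v := fun v => by
    rw [hB]; exact Finset.sum_congr rfl fun _ _ => by ring
  have h6 : ∀ (a : Fin l → K) (s : W), B (P *ᵥ a) s = 0 := fun a s => by
    rw [hPB, LinearMap.mem_ker.mp s.2]; simp
  have h7 : ∀ b : Fin m → K, B (w.equivFun.symm b) (w.equivFun.symm b) =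
      ∑ j, B (w j) (w j) * b j ^ 2 := fun b => by
    simp only [Module.Basis.equivFun_symm_apply, Submodule.coe_sum, Submodule.coe_smul, map_sum,
      LinearMap.sum_apply, map_smul, LinearMap.smul_apply, smul_eq_mul]
    refine Finset.sum_congr rfl fun i _ => ?_
    rw [Finset.sum_eq_single i]
    · ring
    · intro j _ hj
      rw [hw j i hj]; ring
    · simp
  rw [h4, hΦ, map_add B, LinearMap.add_apply, map_add, map_add, h6,
    hsymm (w.equivFun.symm _) (P *ᵥ _), h6, h7, hPB, hTP,
    evalQF, Fin.sum_univ_add]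
  simp only [osum, Fin.append_left, Fin.append_right, add_zero, zero_add]
  congr 1
  exact Finset.sum_congr rfl fun _ _ => by ring

/-- A totally isotropic subspace of rank `k` of a nondegenerate form splits off `k` hyperbolic
planes. -/
theorem HasTotIso.exists_isometric (h2 : (2 : K) ≠ 0) {k : ℕ} {d : Fin n → K} (hd : Nondeg d)
    (h : HasTotIso d (Fin k)) : ∃ (m : ℕ) (r : Fin m → K), Isometric d (osum (hypform k) r) := by
  obtain ⟨U, V, hVU, hU⟩ := h
  set D := diagonal d
  have hDT : Dᵀ = D := Matrix.diagonal_transpose d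
  let Z₀ : Matrix (Fin n) (Fin k) K := diagonal (fun i => (d i)⁻¹) * Vᵀ
  have hDZ : D * Z₀ = Vᵀ := by
    rw [← Matrix.mul_assoc, Matrix.diagonal_mul_diagonal]
    simp [mul_inv_cancel₀ (hd _)]
  have hUZ₀ : Uᵀ * D * Z₀ = 1 := by
    rw [Matrix.mul_assoc, hDZ, ← Matrix.transpose_mul, hVU, Matrix.transpose_one]
  let G := Z₀ᵀ * D * Z₀
  let Z := Z₀ - (2⁻¹ : K) • (U * G)
  have hUZ : Uᵀ * D * Z = 1 := by
    rw [Matrix.mul_sub, hUZ₀, Matrix.mul_smul, ← Matrix.mul_assoc, hU]; simp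
  have hZU : Zᵀ * D * U = 1 := by
    have := congrArg Matrix.transpose hUZ
    simpa [Matrix.transpose_mul, hDT, Matrix.mul_assoc] using this
  have hGT : Gᵀ = G := by simp [G, Matrix.transpose_mul, hDT, Matrix.mul_assoc]
  have hZZ : Zᵀ * D * Z = 0 := by
    have h3 : Zᵀ * D * Z = Zᵀ * D * Z₀ - (2⁻¹ : K) • (Zᵀ * D * U * G) := by
      simp only [Z, Matrix.mul_sub, Matrix.mul_smul, Matrix.mul_assoc]
    have h4 : Zᵀ * D * Z₀ = G - (2⁻¹ : K) • G := by
      simp only [Z, Matrix.transpose_sub, Matrix.transpose_smul, Matrix.transpose_mul, hGT,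
        Matrix.sub_mul, Matrix.smul_mul]
      rw [Matrix.mul_assoc G, Matrix.mul_assoc G, hUZ₀, Matrix.mul_one]
    rw [h3, h4, hZU, Matrix.one_mul, sub_sub, ← add_smul, sub_eq_zero]
    norm_num [← two_mul, h2]
  let P := Matrix.fromCols (U + (2⁻¹ : K) • Z) (U - (2⁻¹ : K) • Z)
  have hP : Pᵀ * D * P = Matrix.fromBlocks 1 0 0 (-1) := by
    have hs : (2⁻¹ : K) • (1 : Matrix (Fin k) (Fin k) K) + (2⁻¹ : K) • 1 = 1 := by
      rw [← add_smul, ← two_mul, mul_inv_cancel₀ h2, one_smul]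
    rw [Matrix.transpose_fromCols, Matrix.fromRows_mul, Matrix.fromRows_mul_fromCols]
    simp only [Matrix.transpose_add, Matrix.transpose_sub, Matrix.transpose_smul, Matrix.add_mul,
      Matrix.sub_mul, Matrix.mul_add, Matrix.mul_sub, Matrix.smul_mul, Matrix.mul_smul, hU, hUZ,
      hZU, hZZ, smul_zero, add_zero, zero_add, sub_zero, zero_sub, sub_self]
    rw [hs, neg_add_cancel, ← neg_add', hs]
  refine exists_isometric_osum_of_gram h2 (e := hypform k)
    (P := P.submatrix id finSumFinEquiv.symm) ?_ ?_
  · intro i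
    refine Fin.addCases (fun i => ?_) (fun i => ?_) i
    · rw [hypform, Fin.append_left]; exact one_ne_zero
    · rw [hypform, Fin.append_right]; exact neg_ne_zero.mpr one_ne_zero
  · have h3 := congrArg (fun M => M.submatrix finSumFinEquiv.symm finSumFinEquiv.symm) hP
    rw [Matrix.submatrix_mul _ P _ id _ Function.bijective_id,
      Matrix.submatrix_mul _ D _ id id Function.bijective_id] at h3
    rw [Matrix.transpose_submatrix]
    refine h3.trans ?_
    rw [← Matrix.diagonal_one, show -diagonal (fun _ : Fin k => (1 : K)) = diagonal fun _ => -1 from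
      Matrix.diagonal_neg _, Matrix.fromBlocks_diagonal, Matrix.submatrix_diagonal_equiv]
    congr 1
    funext i
    refine Fin.addCases (fun i => ?_) (fun i => ?_) i
    · simp [hypform]
    · rw [hypform, Fin.append_right, Function.comp_apply, finSumFinEquiv_symm_apply_natAdd,
        Sum.elim_inr]

theorem HasTotIso.le_wittIndex (h2 : (2 : K) ≠ 0) {k : ℕ} {d : Fin n → K} (hd : Nondeg d)
    (h : HasTotIso d (Fin k)) : k ≤ WittIndex d :=
  le_csSup (bddAbove_wittIndex d) (h.exists_isometric h2 hd)

end Field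
end QF

namespace QF

open Matrix

section Descent

universe v

variable {ι κ : Type*} [Fintype ι] [Fintype κ] [DecidableEq ι] [DecidableEq κ]

/-- Over a principal ideal domain `A`, a totally isotropic subspace defined over the fraction field
saturates to a totally isotropic direct summand defined over `A`. -/
theorem HasTotIso.of_fractionRing {A K : Type*} [CommRing A] [IsDomain A] [IsPrincipalIdealRing A]
    [Field K] [Algebra A K] [IsFractionRing A K] {d : ι → A}
    (h : HasTotIso (fun i => algebraMap A K (d i)) κ) : HasTotIso d κ := by
  obtain ⟨U, V, hVU, hU⟩ := h
  have hinj : Function.Injective (algebraMap A K) := IsFractionRing.injective A K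
  obtain ⟨b, hb⟩ := IsLocalization.exist_integer_multiples_of_finite (nonZeroDivisors A)
    (fun x : ι × κ => U x.1 x.2)
  choose u hu using hb
  have hb0 : algebraMap A K b ≠ 0 := by
    simp
  let U₀ : Matrix ι κ A := Matrix.of fun i j => u (i, j)
  have hU₀ : U₀.map (algebraMap A K) = algebraMap A K b • U := by
    ext i j
    simpa [U₀, Algebra.smul_def] using hu (i, j)
  have hdiag : (diagonal d).map (algebraMap A K) = diagonal fun i => algebraMap A K (d i) := by
    rw [Matrix.diagonal_map (map_zero _)]
  have hiso : U₀ᵀ * diagonal d * U₀ = 0 := by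
    apply Matrix.map_injective hinj
    dsimp only
    rw [Matrix.map_mul, Matrix.map_mul, Matrix.transpose_map, hU₀, hdiag, Matrix.transpose_smul,
      Matrix.smul_mul, Matrix.smul_mul, Matrix.mul_smul, hU, smul_zero, smul_zero]
    exact (Matrix.map_zero _ (map_zero _)).symm
  have hU₀inj : Function.Injective U₀.mulVecLin := by
    rw [← LinearMap.ker_eq_bot, LinearMap.ker_eq_bot']
    intro c hc
    have h1 : (algebraMap A K b • U) *ᵥ (fun i => algebraMap A K (c i)) = 0 := by
      rw [← hU₀]
      funext i
      have h2 := congrArg (algebraMap A K) (congrFun hc i)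
      simpa [Matrix.mulVec, dotProduct] using h2
    have h3 := congrArg (V *ᵥ ·) h1
    simp only [Matrix.smul_mulVec, Matrix.mulVec_smul, Matrix.mulVec_mulVec, hVU,
      Matrix.one_mulVec, Matrix.mulVec_zero] at h3
    funext i
    have h4 := (smul_eq_zero.mp h3).resolve_left hb0
    exact hinj (by simpa using congrFun h4 i)
  obtain ⟨n, S⟩ := Submodule.smithNormalForm (Pi.basisFun A ι) (LinearMap.range U₀.mulVecLin)
  have hn : n = Fintype.card κ := by
    have h1 := (LinearEquiv.ofInjective _ hU₀inj).finrank_eq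
    rw [Module.finrank_eq_card_basis S.bN] at h1
    simpa using h1.symm
  have ha : ∀ j, S.a j ≠ 0 := fun j hj => by
    have h1 := S.snf j
    rw [hj, zero_smul] at h1
    exact S.bN.ne_zero j (Subtype.ext h1)
  have key : HasTotIso d (Fin n) := by
    refine ⟨Matrix.of fun i j => S.bM (S.f j) i,
      Matrix.of fun j i => S.bM.repr (Pi.single i 1) (S.f j), ?_, ?_⟩
    · ext j k
      have h1 : S.bM (S.f k) = ∑ i, S.bM (S.f k) i • (Pi.single i 1 : ι → A) := by
        funext l; simp [Finset.sum_apply, Pi.single_apply]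
      have h2 := congrArg (fun x => S.bM.repr x (S.f j)) h1
      simp only [map_sum, map_smul, Module.Basis.repr_self, Finsupp.coe_finsetSum,
        Finset.sum_apply, Finsupp.smul_apply, smul_eq_mul] at h2
      rw [Matrix.mul_apply, Matrix.one_apply]
      simp only [Matrix.of_apply]
      rw [Finset.sum_congr rfl fun i _ => mul_comm _ _, ← h2, Finsupp.single_apply]
      simp [eq_comm]
    · ext j k
      obtain ⟨x, hx⟩ := (S.bN j).2
      obtain ⟨y, hy⟩ := (S.bN k).2
      rw [S.snf j] at hx
      rw [S.snf k] at hy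
      have h1 : (U₀ *ᵥ x) ⬝ᵥ (diagonal d *ᵥ (U₀ *ᵥ y)) = 0 := by
        rw [Matrix.dotProduct_mulVec, ← Matrix.vecMul_transpose, Matrix.vecMul_vecMul,
          Matrix.dotProduct_mulVec, Matrix.vecMul_vecMul, hiso]
        simp
      rw [show U₀ *ᵥ x = _ from hx, show U₀ *ᵥ y = _ from hy, Matrix.mulVec_smul,
        smul_dotProduct, dotProduct_smul] at h1
      have h2 := (smul_eq_zero.mp ((smul_eq_zero.mp h1).resolve_left (ha j))).resolve_left (ha k)
      rw [Matrix.mul_apply, Matrix.zero_apply, ← h2, dotProduct]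
      simp only [Matrix.mul_diagonal, Matrix.transpose_apply, Matrix.of_apply,
        Matrix.mulVec_diagonal]
      exact Finset.sum_congr rfl fun _ _ => by ring
  exact key.of_embedding (Function.Embedding.nonempty_of_card_le (by simp [hn])).some

/-- Polynomial rings over a field `L` embed into a field `N` such that totally isotropic subspaces
over `N` of forms defined over `L` descend to `L`. -/
theorem exists_field_mvPolynomial (n : ℕ) (L : Type v) [Field L] :
    ∃ (N : Type v) (_ : Field N) (φ : MvPolynomial (Fin n) L →+* N), Function.Injective φ ∧
      ∀ d : ι → L, HasTotIso (fun i => φ (MvPolynomial.C (d i))) κ → HasTotIso d κ := by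
  induction n with
  | zero =>
    refine ⟨L, inferInstance, (MvPolynomial.isEmptyAlgEquiv L (Fin 0)).toRingEquiv.toRingHom,
      (MvPolynomial.isEmptyAlgEquiv L (Fin 0)).injective, fun d h => ?_⟩
    have h1 : ∀ x, MvPolynomial.isEmptyAlgEquiv L (Fin 0) (MvPolynomial.C x) = x :=
      (MvPolynomial.isEmptyAlgEquiv L (Fin 0)).commutes
    have h2 : HasTotIso (fun i => MvPolynomial.isEmptyAlgEquiv L (Fin 0)
      (MvPolynomial.C (d i))) κ := h
    simpa only [h1] using h2
  | succ n ih =>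
    obtain ⟨N, _, φ, hφ, H⟩ := ih
    refine ⟨FractionRing (Polynomial N), inferInstance,
      ((algebraMap (Polynomial N) _).comp (Polynomial.mapRingHom φ)).comp
        (MvPolynomial.finSuccEquiv L n).toRingEquiv.toRingHom, ?_, fun d h => H d ?_⟩
    · simp only [RingHom.coe_comp]
      exact ((IsFractionRing.injective _ _).comp (Polynomial.map_injective φ hφ)).comp
        (MvPolynomial.finSuccEquiv L n).injective
    · have h1 : HasTotIso (fun i => Polynomial.C (φ (MvPolynomial.C (d i)))) κ := by
        apply HasTotIso.of_fractionRing (K := FractionRing (Polynomial N))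
        simpa [MvPolynomial.finSuccEquiv_apply] using h
      simpa using h1.map (Polynomial.evalRingHom 0)

end Descent
end QF

namespace QF

open MvPolynomial

section FunctionField

universe v

/-- An element which is regular modulo `P` stays regular modulo `P` after extending the base
field. -/
theorem map_dvd_of_map_dvd_mul {F L σ : Type*} [Field F] [Field L] (f : F →+* L)
    {P g : MvPolynomial σ F} (hg : ∀ h, P ∣ g * h → P ∣ h) {h : MvPolynomial σ L}
    (hh : map f P ∣ map f g * h) : map f P ∣ h := by
  algebraize [f]
  let _ : Algebra (MvPolynomial σ F) (MvPolynomial σ L) := MvPolynomial.algebraMvPolynomial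
  have hpush : IsBaseChange (MvPolynomial σ F)
      (IsScalarTower.toAlgHom F L (MvPolynomial σ L)).toLinearMap :=
    (inferInstance : Algebra.IsPushout F (MvPolynomial σ F) L (MvPolynomial σ L)).out
  let b := hpush.basis (Module.Basis.ofVectorSpace F L)
  have hsmul : ∀ (a : MvPolynomial σ F) (z : MvPolynomial σ L), map f a * z = a • z :=
    fun a z => (Algebra.smul_def a z).symm
  obtain ⟨r, hr⟩ := hh
  rw [hsmul, hsmul] at hr
  have h1 : ∀ i, P ∣ b.repr h i := fun i => hg _ ⟨b.repr r i, by
    have := congrArg (fun z => b.repr z i) hr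
    simpa using this⟩
  choose s hs using h1
  refine ⟨∑ i ∈ (b.repr h).support, s i • b i, ?_⟩
  rw [hsmul, Finset.smul_sum]
  conv_lhs => rw [← b.linearCombination_repr h, Finsupp.linearCombination_apply, Finsupp.sum]
  refine Finset.sum_congr rfl fun i _ => ?_
  rw [hs i, mul_smul]

theorem sum_mul_sub_mul_sq {R ι : Type*} [CommRing R] [Fintype ι] (d x y : ι → R) (t : R) :
    ∑ i, d i * (y i - t * x i) ^ 2 =
      ∑ i, d i * y i ^ 2 - t * ∑ i, 2 * d i * x i * y i + t ^ 2 * ∑ i, d i * x i ^ 2 := by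
  simp only [Finset.mul_sum, ← Finset.sum_sub_distrib, ← Finset.sum_add_distrib]
  exact Finset.sum_congr rfl fun _ _ => by ring

/-- Projection from a rational point parametrizes an isotropic quadric: it yields a homomorphism
`ψ` from the polynomial ring into a field containing a polynomial ring, killing the equation
of the quadric, and with kernel the equation up to powers of the tangent hyperplane `B`. -/
theorem exists_ringHom_formPoly_eq_zero {L N : Type*} [Field L] [Field N] (h2 : (2 : L) ≠ 0)
    {n : ℕ} {d : Fin n → L} (hd : Nondeg d) (hz : HasZero d) (φ : MvPolynomial (Fin n) L →+* N)
    (hφ : Function.Injective φ) :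
    ∃ (ψ : MvPolynomial (Fin n) L →+* N) (B : MvPolynomial (Fin n) L),
      (∀ c, ψ (C c) = φ (C c)) ∧ ψ (formPoly d) = 0 ∧ (∀ e, ¬ formPoly d ∣ B ^ e) ∧
      ∀ g, ψ g = 0 → ∃ e, formPoly d ∣ g * B ^ e := by
  obtain ⟨x, hx0, hx⟩ := hz
  obtain ⟨i₀, hi₀⟩ := Function.ne_iff.mp hx0
  set P := formPoly d
  have hevalP : ∀ y, eval y P = ∑ i, d i * y i ^ 2 := fun y => by simp [P, formPoly]
  let B : MvPolynomial (Fin n) L := ∑ i, C (2 * d i * x i) * X i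
  have hevalB : ∀ y, eval y B = ∑ i, 2 * d i * x i * y i := fun y => by simp [B]
  have hevalB₀ : eval (Pi.single i₀ 1) B ≠ 0 := by
    rw [hevalB]
    simpa [Pi.single_apply, h2, hd i₀] using hi₀
  have hB0 : B ≠ 0 := fun h => hevalB₀ (by rw [h, map_zero])
  have hβ : φ B ≠ 0 := fun h => hB0 (hφ (h.trans (map_zero φ).symm))
  set t := φ P * (φ B)⁻¹ with ht
  let ψ : MvPolynomial (Fin n) L →+* N := eval₂Hom (φ.comp C) fun i => φ (X i) - t * φ (C (x i))
  have hψC : ∀ c, ψ (C c) = φ (C c) := fun c => by simp [ψ]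
  have hψX : ∀ i, ψ (X i) = φ (X i) - t * φ (C (x i)) := fun i => by simp [ψ]
  refine ⟨ψ, B, hψC, ?_, fun e hdvd => ?_, fun g hg => ?_⟩
  · have h1 : ∑ i, φ (C (d i)) * φ (X i) ^ 2 = φ P := by simp [P, formPoly]
    have h3 : ∑ i, 2 * φ (C (d i)) * φ (C (x i)) * φ (X i) = φ B := by
      simp [B, show φ (C (2 : L)) = 2 from map_ofNat (φ.comp C) 2]
    have h4 : ∑ i, φ (C (d i)) * φ (C (x i)) ^ 2 = 0 := by
      rw [← map_zero φ, ← map_zero C, ← hx]; simp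
    calc ψ P = ∑ i, φ (C (d i)) * (φ (X i) - t * φ (C (x i))) ^ 2 := by
          simp only [P, formPoly, map_sum, map_mul, map_pow, hψC, hψX]
      _ = 0 := by
          rw [sum_mul_sub_mul_sq, h1, h3, h4, ht]
          field_simp
          ring
  · let y₀ : Fin n → L := Pi.single i₀ 1
    let y : Fin n → L := fun i => y₀ i - eval y₀ P / eval y₀ B * x i
    have hyP : eval y P = 0 := by
      rw [hevalP, sum_mul_sub_mul_sq, hx, ← hevalB, ← hevalP, div_mul_cancel₀ _ hevalB₀]
      ring
    have hyB : eval y B = eval y₀ B := by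
      have h1 : ∑ i, 2 * d i * x i * x i = 0 := by
        trans 2 * ∑ i, d i * x i ^ 2
        · rw [Finset.mul_sum]
          exact Finset.sum_congr rfl fun _ _ => by ring
        · rw [hx, mul_zero]
      calc eval y B = ∑ i, 2 * d i * x i * y₀ i -
            eval y₀ P / eval y₀ B * ∑ i, 2 * d i * x i * x i := by
            rw [hevalB, Finset.mul_sum, ← Finset.sum_sub_distrib]
            exact Finset.sum_congr rfl fun _ _ => by simp only [y]; ring
        _ = eval y₀ B := by rw [h1, mul_zero, sub_zero, hevalB]
    have h1 := map_dvd (eval y) hdvd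
    rw [hyP, zero_dvd_iff, map_pow, hyB] at h1
    exact pow_ne_zero e hevalB₀ h1
  · have key : ∀ g, ∃ (e : ℕ) (r : MvPolynomial (Fin n) L),
        φ B ^ e * ψ g = φ (B ^ e * g - P * r) := by
      intro g
      induction g using MvPolynomial.induction_on with
      | C c => exact ⟨0, 0, by simp [hψC]⟩
      | add g₁ g₂ ih₁ ih₂ =>
        obtain ⟨e₁, r₁, h₁⟩ := ih₁
        obtain ⟨e₂, r₂, h₂⟩ := ih₂
        refine ⟨e₁ + e₂, B ^ e₂ * r₁ + B ^ e₁ * r₂, ?_⟩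
        simp only [map_sub, map_add, map_mul, map_pow] at h₁ h₂ ⊢
        linear_combination φ B ^ e₂ * h₁ + φ B ^ e₁ * h₂
      | mul_X g i ih =>
        obtain ⟨e, r, h⟩ := ih
        refine ⟨e + 1, B ^ e * g * C (x i) + r * B * X i - P * r * C (x i), ?_⟩
        have h1 : φ B * t = φ P := by rw [ht]; field_simp
        simp only [map_sub, map_add, map_mul, map_pow, hψX] at h ⊢
        linear_combination (φ B * φ (X i) - φ B * t * φ (C (x i))) * h -
          (φ B ^ e * φ g - φ P * φ r) * φ (C (x i)) * h1
    obtain ⟨e, r, h⟩ := key g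
    rw [hg, mul_zero, eq_comm, map_eq_zero_iff φ hφ, sub_eq_zero] at h
    exact ⟨e, r, by rw [mul_comm, h]⟩

theorem map_formPoly {R S : Type*} [CommRing R] [CommRing S] (f : R →+* S) {n : ℕ} (d : Fin n → R) :
    map f (formPoly d) = formPoly fun i => f (d i) := by
  simp [formPoly]

/-- The function field of `p` is generic for the isotropy of `p`: totally isotropic subspaces over
`F(p)` specialize to every extension over which `p` is isotropic. -/
theorem forcesTotIso_of_funField {F : Type*} [Field F] (h2 : (2 : F) ≠ 0) {m n : ℕ}
    {p : Fin n → F} (hp : Nondeg p) {q : Fin m → F} {κ : Type*} [Fintype κ] [DecidableEq κ]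
    (h : HasTotIso (bc (algebraMap F (FunField p)) q) κ) : ForcesTotIso.{_, v} p q κ := by
  intro L _ f hz
  have h2' : (2 : L) ≠ 0 := by
    rw [← map_ofNat f 2]; exact (map_ne_zero f).mpr h2
  obtain ⟨N, _, φ, hφ, hdesc⟩ := exists_field_mvPolynomial (ι := Fin m) (κ := κ) n L
  obtain ⟨ψ, B, hψC, hψP, hB, hψ⟩ := exists_ringHom_formPoly_eq_zero h2'
    (fun i => (map_ne_zero f).mpr (hp i)) hz φ hφ
  rw [← map_formPoly] at hψP
  simp only [← map_formPoly] at hB hψ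
  let χ : CoordRing p →+* N := Ideal.Quotient.lift _ (ψ.comp (map f)) fun a ha => by
    obtain ⟨b, rfl⟩ := Ideal.mem_span_singleton.mp ha
    simp [hψP]
  have hχ : ∀ y : nonZeroDivisors (CoordRing p), IsUnit (χ y) := by
    rintro ⟨y, hy⟩
    obtain ⟨g, rfl⟩ := Ideal.Quotient.mk_surjective y
    rw [isUnit_iff_ne_zero]
    intro h0
    obtain ⟨e, he⟩ := hψ (map f g) h0
    refine hB e (map_dvd_of_map_dvd_mul f (fun h hdvd => ?_) he)
    rw [← Ideal.mem_span_singleton, ← Ideal.Quotient.eq_zero_iff_mem] at hdvd ⊢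
    rw [map_mul, mul_comm] at hdvd
    exact (mem_nonZeroDivisors_iff_right.mp hy) _ hdvd
  refine hdesc _ ?_
  have h3 := h.map (IsLocalization.lift (S := FunField p) hχ)
  refine (congrArg (fun d => HasTotIso d κ) (funext fun i => ?_)).mp h3
  rw [bc, IsScalarTower.algebraMap_apply F (CoordRing p) (FunField p), IsLocalization.lift_eq,
    ← hψC]
  change ψ (map f (C (q i))) = _
  rw [map_C]

end FunctionField
end QF

namespace QF

open Matrix Kronecker

section PfisterMultiples

theorem sum_mul_sq_eq_dotProduct {R ι : Type*} [CommRing R] [Fintype ι] [DecidableEq ι]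
    (d v : ι → R) : ∑ i, d i * v i ^ 2 = v ⬝ᵥ (diagonal d *ᵥ v) := by
  simp only [dotProduct, Matrix.mulVec_diagonal]
  exact Finset.sum_congr rfl fun _ _ => by ring

theorem HasZero.congr {R ι ι' : Type*} [CommRing R] [Fintype ι] [Fintype ι'] [DecidableEq ι]
    [DecidableEq ι'] {d : ι → R} {e : ι' → R} {M : Matrix ι' ι R} {N : Matrix ι ι' R}
    (hNM : N * M = 1) (hG : Mᵀ * diagonal e * M = diagonal d) (h : HasZero d) : HasZero e := by
  obtain ⟨v, hv0, hv⟩ := h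
  refine ⟨M *ᵥ v, fun h0 => hv0 ?_, ?_⟩
  · simpa [Matrix.mulVec_mulVec, hNM] using congrArg (N *ᵥ ·) h0
  · rw [sum_mul_sq_eq_dotProduct, ← hv, sum_mul_sq_eq_dotProduct, ← hG, ← Matrix.mulVec_mulVec,
      ← Matrix.mulVec_mulVec, Matrix.dotProduct_mulVec v, Matrix.vecMul_transpose]

theorem kronecker_one_transpose_mul_diagonal_mul {R β β' ι : Type*} [CommRing R] [Fintype β]
    [Fintype β'] [Fintype ι] [DecidableEq β] [DecidableEq β'] [DecidableEq ι] {d : β → R}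
    {e : β' → R} {M : Matrix β' β R} (hG : Mᵀ * diagonal e * M = diagonal d) (q : ι → R) :
    (M ⊗ₖ 1 : Matrix (β' × ι) (β × ι) R)ᵀ * diagonal (tprod e q) *
      (M ⊗ₖ 1 : Matrix (β' × ι) (β × ι) R) = diagonal (tprod d q) := by
  rw [diagonal_tprod, diagonal_tprod, show (M ⊗ₖ 1 : Matrix (β' × ι) (β × ι) R)ᵀ = Mᵀ ⊗ₖ 1ᵀ from
    (kroneckerMap_transpose _ _ _).symm, ← mul_kronecker_mul, ← mul_kronecker_mul, hG,
    Matrix.transpose_one, Matrix.one_mul, Matrix.mul_one]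

theorem Isometric.nondeg {F : Type*} [Field F] (h2 : (2 : F) ≠ 0) {m n : ℕ} {d : Fin m → F}
    {e : Fin n → F} (h : Isometric d e) (he : Nondeg e) : Nondeg d := by
  obtain rfl := h.card_eq
  obtain ⟨M, N, hMN, -, hG⟩ := h.exists_matrix h2.isUnit
  have h1 := congrArg Matrix.det hG
  rw [Matrix.det_mul, Matrix.det_mul, Matrix.det_transpose, Matrix.det_diagonal,
    Matrix.det_diagonal] at h1
  have hM : M.det ≠ 0 := fun h0 => by simpa [h0] using congrArg Matrix.det hMN
  have h3 : ∏ i, d i ≠ 0 := by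
    rw [← h1]
    exact mul_ne_zero (mul_ne_zero hM (Finset.prod_ne_zero_iff.mpr fun i _ => he i)) hM
  exact fun i => Finset.prod_ne_zero_iff.mp h3 i (Finset.mem_univ i)

theorem nontrivial_coordRing {F : Type*} [Field F] {n : ℕ} (p : Fin n → F) :
    Nontrivial (CoordRing p) := by
  refine Ideal.Quotient.nontrivial_iff.mpr fun h => ?_
  obtain ⟨g, hg⟩ := Ideal.mem_span_singleton.mp (h ▸ Submodule.mem_top :
    (1 : MvPolynomial (Fin n) F) ∈ Ideal.span {formPoly p})
  simpa [formPoly] using congrArg (MvPolynomial.eval 0) hg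

theorem nondeg_pfisterOf {F : Type*} [Field F] {n : ℕ} {a : Fin n → F} (ha : ∀ i, a i ≠ 0) :
    Nondeg (pfisterOf a) := fun i =>
  Finset.prod_ne_zero_iff.mpr fun j _ => by
    split_ifs
    exacts [one_ne_zero, ha j]

theorem mul_wittIndex_le_wittIndex_tensorQF {F : Type*} [Field F] (h2 : (2 : F) ≠ 0)
    {np nq mπ : ℕ} {p : Fin np → F} {q : Fin nq → F} {π : Fin mπ → F}
    (hp : Nondeg p) (hq : Nondeg q) (hπ : IsPfister π) {K : Type*} [Field K] (f : F →+* K)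
    (hiso : Isotropic (bc f (tensorQF π p))) :
    mπ * WittIndex (bc (algebraMap F (FunField p)) q) ≤ WittIndex (bc f (tensorQF π q)) := by
  obtain ⟨n, a, ha, hπa⟩ := hπ
  have := nontrivial_coordRing p
  have hunit : IsUnit (2 : FunField p) := by
    rw [← map_ofNat (algebraMap F (FunField p)) 2]
    exact h2.isUnit.map _
  obtain ⟨hU, hk⟩ := hasTotIso_wittIndex hunit (bc (algebraMap F (FunField p)) q)
  set k := WittIndex (bc (algebraMap F (FunField p)) q)
  have h2K : (2 : K) ≠ 0 := by
    rw [← map_ofNat f 2]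
    exact (map_ne_zero _).mpr h2
  have hforce := (forcesTotIso_of_funField h2 hp hU).tprod_pfister a (by simpa using hk)
  obtain ⟨M, N, hMN, hNM, hG⟩ := hπa.exists_matrix h2.isUnit
  have hMN' : M.map f * N.map f = 1 := by
    rw [← Matrix.map_mul, hMN, Matrix.map_one _ (map_zero _) (map_one _)]
  have hNM' : N.map f * M.map f = 1 := by
    rw [← Matrix.map_mul, hNM, Matrix.map_one _ (map_zero _) (map_one _)]
  have hG' : (M.map f)ᵀ * diagonal (bc f (pfisterOf a)) * M.map f = diagonal (bc f π) := by
    have hdiag : ∀ {l : ℕ} (d : Fin l → F), (diagonal d).map f = diagonal (bc f d) :=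
      fun d => Matrix.diagonal_map (map_zero f)
    rw [← hdiag, ← hdiag, ← hG, Matrix.map_mul, Matrix.map_mul, Matrix.transpose_map]
  have hpf : ∀ {l : ℕ} (d : Fin l → F) (x : (Fin n → Fin 2) × Fin l),
      tprod (bc f (pfisterOf a)) (bc f d) (finFunctionFinEquiv x.1, x.2) =
        f (tprod (pfisterCoeff a) d x) := fun d x => by
    simp [bc, pfisterOf, pfisterCoeff, tprod]
  have hzero : HasZero fun x => f (tprod (pfisterCoeff a) p x) := by
    have h3 : HasZero (tprod (bc f π) (bc f p)) := by
      refine (congrArg HasZero (funext fun x => ?_)).mp (HasZero.reindex hiso finProdFinEquiv)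
      rw [bc, tensorQF, Equiv.symm_apply_apply, map_mul]
      rfl
    have h4 := HasZero.congr (N := N.map f ⊗ₖ 1)
      (by rw [← mul_kronecker_mul, hNM', Matrix.one_mul, one_kronecker_one])
      (kronecker_one_transpose_mul_diagonal_mul hG' (bc f p)) h3
    exact (congrArg HasZero (funext (hpf p))).mp
      (h4.reindex (finFunctionFinEquiv.prodCongr (Equiv.refl (Fin np))))
  have htot : HasTotIso (tprod (bc f (pfisterOf a)) (bc f q)) ((Fin n → Fin 2) × Fin k) := by
    refine (congrArg (fun d => HasTotIso d _) (funext fun x => ?_)).mp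
      ((hforce K f hzero).reindex (finFunctionFinEquiv.symm.prodCongr (Equiv.refl (Fin nq))))
    rw [← hpf]
    simp
  have hcongr := HasTotIso.congr (N := N.map f ⊗ₖ 1)
    (by rw [← mul_kronecker_mul, hMN', Matrix.one_mul, one_kronecker_one])
    (kronecker_one_transpose_mul_diagonal_mul hG' (bc f q)) htot
  have hfin := (hcongr.reindex finProdFinEquiv.symm).of_embedding (κ' := Fin (mπ * k))
    (Function.Embedding.nonempty_of_card_le (by simp [hπa.card_eq])).some
  have hπ0 := hπa.nondeg h2 (nondeg_pfisterOf ha)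
  refine HasTotIso.le_wittIndex h2K (fun i => (map_ne_zero _).mpr (mul_ne_zero (hπ0 _) (hq _))) ?_
  refine (congrArg (fun d => HasTotIso d _) (funext fun x => ?_)).mp hfin
  rw [bc, tensorQF, map_mul]
  rfl

end PfisterMultiples
end QF

open QF in
/-- Theorem on the isotropy of Pfister multiples: let `p`, `q` be forms over `F` (char `F ≠ 2`)
and `π` a Pfister form over `F`. If `K/F` is any field extension such that `π ⊗ p` is isotropic
over `K`, then `i((π ⊗ q)_K) ≥ (dim π) · i(q_{F(p)})`. -/
theorem stmt_6 {F : Type*} [Field F] (h2 : (2 : F) ≠ 0)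
    {np nq mπ : ℕ} (p : Fin np → F) (q : Fin nq → F) (π : Fin mπ → F)
    (hp : Nondeg p) (hq : Nondeg q) (hp0 : 0 < np) (hq0 : 0 < nq)
    (hπ : IsPfister π)
    (K : Type*) [Field K] [Algebra F K]
    (hiso : Isotropic (bc (algebraMap F K) (tensorQF π p))) :
    mπ * WittIndex (bc (algebraMap F (FunField p)) q)
      ≤ WittIndex (bc (algebraMap F K) (tensorQF π q)) :=
  mul_wittIndex_le_wittIndex_tensorQF h2 hp hq hπ (algebraMap F K) hiso
end

section
/- Let F be a field of characteristic different from two, and let p and q be forms over F with p anisotropic. If q becomes hyperbolic over the function field F(p), then H_F(p) ⊆ G_F(q), i.e. every a ∈ F× such that ⟨1,−a⟩ ⊗ p is isotropic over F is a similarity factor of q. -/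
set_option synthInstance.maxHeartbeats 1000000
set_option maxHeartbeats 4000000

open scoped BigOperators Classical

namespace QF

section Gram

variable {ι κ R S : Type*} [Fintype ι] [Fintype κ] [CommRing R] [CommRing S]

/-- The bilinear form on `ι → R` with Gram matrix `Q`. -/
noncomputable abbrev bil (Q : Matrix ι ι R) : LinearMap.BilinForm R (ι → R) := Matrix.toBilin' Q

theorem bil_apply (Q : Matrix ι ι R) (x y : ι → R) :
    bil Q x y = ∑ i, ∑ j, x i * Q i j * y j :=
  Matrix.toBilin'_apply Q x y

theorem map_bil (f : R →+* S) (Q : Matrix ι ι R) (x y : ι → R) :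
    f (bil Q x y) = bil (Q.map f) (fun i => f (x i)) (fun i => f (y i)) := by
  simp [bil_apply, map_sum, map_mul]

theorem bil_comm {Q : Matrix ι ι R} (hQ : Q.IsSymm) (x y : ι → R) :
    bil Q x y = bil Q y x := by
  rw [bil_apply, bil_apply, Finset.sum_comm]
  refine Finset.sum_congr rfl fun i _ => Finset.sum_congr rfl fun j _ => ?_
  rw [hQ.apply]
  ring

end Gram

section Place

variable {ι F H : Type*} [Fintype ι] [Field F] [Field H] {O : ValuationSubring H}
  {ρ : O →+* F} {s : F →+* O}

/-- Over a field with an `F`-rational place, a vector is a scalar multiple of an integral vector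
on which an anisotropic form takes a unit value. -/
theorem exists_primitive_vector (hs : ∀ a, ρ (s a) = a) (hρ : ∀ z : O, ρ z ≠ 0 → IsUnit z)
    {Q : Matrix ι ι F} (hQ : ∀ x, bil Q x x = 0 → x = 0) {y : ι → H} (hy : y ≠ 0) :
    ∃ (t : H) (z : ι → O), t ≠ 0 ∧ (∀ i, y i = t * z i) ∧ IsUnit (bil (Q.map s) z z) := by
  obtain ⟨k, hk⟩ := Function.ne_iff.mp hy
  obtain ⟨j, -, hj⟩ := Finset.exists_max_image Finset.univ (fun i => O.valuation (y i))
    ⟨k, Finset.mem_univ k⟩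
  have hj0 : y j ≠ 0 := by
    intro h
    have h1 := hj k (Finset.mem_univ k)
    simp only [h, map_zero, le_zero_iff, map_eq_zero] at h1
    exact hk h1
  have h_mem : ∀ i, y i / y j ∈ O := by
    intro i
    rw [← ValuationSubring.valuation_le_one_iff, map_div₀]
    exact div_le_one_of_le₀ (hj i (Finset.mem_univ i)) zero_le
  refine ⟨y j, fun i => ⟨y i / y j, h_mem i⟩, hj0, fun i => ?_, hρ _ fun h => ?_⟩
  · simp only
    field_simp
  · rw [map_bil, Matrix.map_map] at h
    have hmap : Q.map (ρ ∘ s) = Q := by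
      ext a b
      simp [hs]
    rw [hmap] at h
    have h1 := congrFun (hQ _ h) j
    simp only [Pi.zero_apply] at h1
    have h2 : (⟨y j / y j, h_mem j⟩ : O) = 1 := Subtype.ext (div_self hj0)
    rw [h2, map_one] at h1
    exact one_ne_zero h1

theorem bil_primitive_vector {Q : Matrix ι ι F} {y : ι → H} {t : H} {z : ι → O}
    (h : ∀ i, y i = t * z i) :
    bil (Q.map (O.subtype.comp s)) y y = t ^ 2 * (bil (Q.map s) z z : O) := by
  have h1 : y = t • fun i => O.subtype (z i) := funext fun i => by simpa using h i
  have h2 := map_bil O.subtype (Q.map s) z z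
  rw [Matrix.map_map] at h2
  rw [h1, map_smul, map_smul, LinearMap.smul_apply, smul_smul, smul_eq_mul, ← sq]
  congr 1
  exact h2.symm

theorem anisotropic_of_place (hs : ∀ a, ρ (s a) = a) (hρ : ∀ z : O, ρ z ≠ 0 → IsUnit z)
    {Q : Matrix ι ι F} (hQ : ∀ x, bil Q x x = 0 → x = 0) (y : ι → H)
    (hy : bil (Q.map (O.subtype.comp s)) y y = 0) : y = 0 := by
  by_contra hy0
  obtain ⟨t, z, ht, hz, hu⟩ := exists_primitive_vector hs hρ hQ hy0
  rw [bil_primitive_vector hz, mul_eq_zero] at hy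
  rcases hy with hy | hy
  · exact ht (pow_eq_zero_iff two_ne_zero |>.mp hy)
  · exact hu.ne_zero (Subtype.ext hy)

theorem mem_of_bil_mem (hs : ∀ a, ρ (s a) = a) (hρ : ∀ z : O, ρ z ≠ 0 → IsUnit z)
    {Q : Matrix ι ι F} (hQ : ∀ x, bil Q x x = 0 → x = 0) (y : ι → H)
    (hy : bil (Q.map (O.subtype.comp s)) y y ∈ O) (i : ι) : y i ∈ O := by
  by_cases hy0 : y = 0
  · simp [hy0, O.zero_mem]
  obtain ⟨t, z, ht, hz, hu⟩ := exists_primitive_vector hs hρ hQ hy0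
  rw [bil_primitive_vector hz] at hy
  have ht2 : t ^ 2 ∈ O := by
    obtain ⟨u, hu⟩ := hu
    have := O.mul_mem _ _ hy (u⁻¹ : Oˣ).1.2
    rw [← hu, mul_assoc, ← O.coe_mul] at this
    simpa using this
  have ht1 : t ∈ O := by
    rw [← ValuationSubring.valuation_le_one_iff] at ht2 ⊢
    rw [map_pow] at ht2
    exact (pow_le_one_iff two_ne_zero).mp ht2
  rw [hz]
  exact O.mul_mem _ _ ht1 (z i).2

end Place

section Similitude

variable {ι F : Type*} [Fintype ι] [Field F]

/-- `a` is a similarity factor of the quadratic form with Gram matrix `Q`. -/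
def Sim (Q : Matrix ι ι F) (a : F) : Prop :=
  ∃ f : (ι → F) ≃ₗ[F] (ι → F), ∀ x, bil Q (f x) (f x) = a * bil Q x x

end Similitude

section QuadraticExtension

variable {ι H : Type*} [Fintype ι] [Field H] {c : H}

theorem re_bil (Q : Matrix ι ι H) (w : ι → QuadraticAlgebra H c 0) :
    (bil (Q.map (algebraMap H (QuadraticAlgebra H c 0))) w w).re =
      bil Q (fun i => (w i).re) (fun i => (w i).re) +
        c * bil Q (fun i => (w i).im) (fun i => (w i).im) := by
  have h : ∀ z : QuadraticAlgebra H c 0, z.re = QuadraticAlgebra.reₗ c 0 z := fun _ => rfl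
  rw [h]
  simp only [bil_apply, map_sum, Finset.mul_sum, ← Finset.sum_add_distrib]
  refine Finset.sum_congr rfl fun i _ => Finset.sum_congr rfl fun j _ => ?_
  rw [← h]
  simp
  ring

theorem im_bil {Q : Matrix ι ι H} (hQ : Q.IsSymm) (w : ι → QuadraticAlgebra H c 0) :
    (bil (Q.map (algebraMap H (QuadraticAlgebra H c 0))) w w).im =
      2 * bil Q (fun i => (w i).re) (fun i => (w i).im) := by
  have h : ∀ z : QuadraticAlgebra H c 0, z.im = QuadraticAlgebra.imₗ c 0 z := fun _ => rfl
  rw [two_mul, h]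
  nth_rewrite 2 [bil_comm hQ (fun i => (w i).re)]
  simp only [bil_apply, map_sum, ← Finset.sum_add_distrib]
  refine Finset.sum_congr rfl fun i _ => Finset.sum_congr rfl fun j _ => ?_
  rw [← h]
  simp

/-- An anisotropic form that becomes hyperbolic over `H(√c)` admits a skew similitude `S` with
`bil Q (S x) (S x) = -c * bil Q x x`. -/
theorem exists_skew_similitude (h2 : (2 : H) ≠ 0) [hc : Fact (∀ r : H, r ^ 2 ≠ c + 0 * r)]
    {Q : Matrix ι ι H} (hQs : Q.IsSymm) (hQ : ∀ x, bil Q x x = 0 → x = 0)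
    (W : Submodule (QuadraticAlgebra H c 0) (ι → QuadraticAlgebra H c 0))
    (hW : ∀ w ∈ W, bil (Q.map (algebraMap H (QuadraticAlgebra H c 0))) w w = 0)
    (hdim : Fintype.card ι ≤ 2 * Module.finrank (QuadraticAlgebra H c 0) W) :
    ∃ S : (ι → H) →ₗ[H] (ι → H), (∀ x, bil Q (S x) (S x) = -c * bil Q x x) ∧
      ∀ x, bil Q x (S x) = 0 := by
  have hc0 : c ≠ 0 := by
    rintro rfl
    exact hc.out 0 (by simp)
  have hre : ∀ w ∈ W, bil Q (fun i => (w i).re) (fun i => (w i).re) +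
      c * bil Q (fun i => (w i).im) (fun i => (w i).im) = 0 := fun w hw => by
    rw [← re_bil, hW w hw]; rfl
  have him : ∀ w ∈ W, bil Q (fun i => (w i).re) (fun i => (w i).im) = 0 := fun w hw => by
    have := im_bil hQs w
    rw [hW w hw] at this
    exact (mul_eq_zero.mp this.symm).resolve_left h2
  let reW : W →ₗ[H] (ι → H) :=
    { toFun := fun w i => (w.1 i).re
      map_add' := fun _ _ => rfl
      map_smul' := fun _ _ => rfl }
  let imW : W →ₗ[H] (ι → H) :=
    { toFun := fun w i => (w.1 i).im
      map_add' := fun _ _ => rfl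
      map_smul' := fun _ _ => rfl }
  have hinj : Function.Injective reW := by
    rw [← LinearMap.ker_eq_bot, LinearMap.ker_eq_bot']
    intro w hw
    have h1 : (fun i => (w.1 i).re) = 0 := hw
    have h3 := hre w.1 w.2
    rw [h1, map_zero, zero_add] at h3
    have h4 := hQ _ ((mul_eq_zero.mp h3).resolve_left hc0)
    ext i
    · exact congrFun h1 i
    · exact congrFun h4 i
  have : Module.Finite H W := Module.Finite.of_injective reW hinj
  have hfin : Module.finrank H W = Module.finrank H (ι → H) := by
    refine le_antisymm (LinearMap.finrank_le_finrank_of_injective hinj) ?_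
    rw [Module.finrank_fintype_fun_eq_card,
      ← Module.finrank_mul_finrank H (QuadraticAlgebra H c 0) W,
      QuadraticAlgebra.finrank_eq_two]
    exact hdim
  let e : W ≃ₗ[H] (ι → H) := LinearMap.linearEquivOfInjective reW hinj hfin
  have he : ∀ x, (fun i => ((e.symm x).1 i).re) = x := fun x => e.apply_symm_apply x
  refine ⟨c • imW ∘ₗ e.symm.toLinearMap, fun x => ?_, fun x => ?_⟩
  · have h1 := hre _ (e.symm x).2
    rw [he] at h1
    change bil Q (c • fun i => ((e.symm x).1 i).im) (c • fun i => ((e.symm x).1 i).im) = _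
    rw [map_smul, map_smul, LinearMap.smul_apply, smul_eq_mul, smul_eq_mul]
    linear_combination c * h1
  · have h1 := him _ (e.symm x).2
    rw [he] at h1
    change bil Q x (c • fun i => ((e.symm x).1 i).im) = _
    rw [map_smul, h1, smul_zero]

end QuadraticExtension

section Place

variable {ι F H : Type*} [Fintype ι] [Field F] [Field H] {O : ValuationSubring H}
  {ρ : O →+* F} {s : F →+* O}

/-- Specialization of a skew similitude along a rational place, and the similitudes of norm type
that it gives rise to. -/
theorem sim_of_skew_similitude (hs : ∀ a, ρ (s a) = a) (hρ : ∀ z : O, ρ z ≠ 0 → IsUnit z)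
    {Q : Matrix ι ι F} (hQs : Q.IsSymm) (hQ : ∀ x, bil Q x x = 0 → x = 0) (c : O)
    (S : (ι → H) →ₗ[H] (ι → H))
    (hS : ∀ x, bil (Q.map (O.subtype.comp s)) (S x) (S x) =
      -c * bil (Q.map (O.subtype.comp s)) x x)
    (hS' : ∀ x, bil (Q.map (O.subtype.comp s)) x (S x) = 0)
    {l : F} (hl : l ^ 2 - ρ c ≠ 0) : Sim Q (l ^ 2 - ρ c) := by
  let j : (ι → F) → (ι → H) := fun x i => s (x i)
  have hj : ∀ x y, bil (Q.map (O.subtype.comp s)) (j x) (j y) = s (bil Q x y) := fun x y =>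
    (map_bil (O.subtype.comp s) Q x y).symm
  have h_mem : ∀ x i, S (j x) i ∈ O := fun x i => by
    refine mem_of_bil_mem hs hρ hQ _ ?_ i
    rw [hS, hj]
    exact O.mul_mem _ _ (O.neg_mem _ c.2) (s (bil Q x x)).2
  let SO : (ι → F) → (ι → O) := fun x i => ⟨S (j x) i, h_mem x i⟩
  have hmap : (Q.map s).map ρ = Q := by
    ext a b
    simp [hs]
  let S₀ : (ι → F) →ₗ[F] (ι → F) :=
    { toFun := fun x i => ρ (SO x i)
      map_add' := fun x y => by
        have h : j (x + y) = j x + j y := by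
          ext i
          simp [j]
        ext i
        rw [Pi.add_apply, ← map_add]
        congr 1
        ext
        simp [SO, h]
      map_smul' := fun a x => by
        have h : j (a • x) = (s a : H) • j x := by
          ext i
          simp [j]
        ext i
        rw [RingHom.id_apply, Pi.smul_apply, smul_eq_mul]
        nth_rewrite 2 [← hs a]
        rw [← map_mul]
        congr 1
        ext
        simp [SO, h] }
  have h1 : ∀ x, bil Q (S₀ x) (S₀ x) = -ρ c * bil Q x x := fun x => by
    have h : bil (Q.map s) (SO x) (SO x) = -c * s (bil Q x x) := by
      apply O.subtype_injective
      rw [map_bil, Matrix.map_map]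
      refine (hS (j x)).trans ?_
      rw [hj]
      simp
    have h' := congrArg ρ h
    rw [map_bil, hmap, map_mul, map_neg, hs] at h'
    exact h'
  have h2 : ∀ x, bil Q x (S₀ x) = 0 := fun x => by
    have h : bil (Q.map s) (fun i => s (x i)) (SO x) = 0 := by
      apply O.subtype_injective
      rw [map_bil, Matrix.map_map, map_zero]
      exact hS' (j x)
    have h' := congrArg ρ h
    rw [map_bil, hmap, map_zero] at h'
    simp only [hs] at h'
    exact h'
  let f : (ι → F) →ₗ[F] (ι → F) := l • LinearMap.id + S₀
  have hf : ∀ x, bil Q (f x) (f x) = (l ^ 2 - ρ c) * bil Q x x := fun x => by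
    have h3 : bil Q (S₀ x) x = 0 := by rw [bil_comm hQs, h2]
    change bil Q (l • x + S₀ x) (l • x + S₀ x) = _
    simp only [map_add, map_smul, LinearMap.add_apply, LinearMap.smul_apply, h1, h2, h3,
      smul_eq_mul]
    ring
  have hinj : Function.Injective f := by
    rw [← LinearMap.ker_eq_bot, LinearMap.ker_eq_bot']
    intro x hx
    have h3 := hf x
    rw [hx, map_zero] at h3
    exact hQ x ((mul_eq_zero.mp h3.symm).resolve_left hl)
  exact ⟨LinearEquiv.ofInjectiveEndo f hinj, hf⟩

end Place

section HyperbolicReduction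

variable {ι κ F Ω : Type*} [Fintype ι] [Fintype κ] [Field F] [Field Ω]

/-- No nonzero vector is orthogonal to the whole space. -/
def GramNondeg (Q : Matrix ι ι F) : Prop := ∀ x, (∀ y, bil Q x y = 0) → x = 0

/-- Over `Ω` the form has a totally isotropic subspace of at least half the dimension. -/
def IsMetabolicOver (φ : F →+* Ω) (Q : Matrix ι ι F) : Prop :=
  ∃ W : Submodule Ω (ι → Ω), (∀ w ∈ W, bil (Q.map φ) w w = 0) ∧
    Fintype.card ι ≤ 2 * Module.finrank Ω W

theorem bil_congruence {R : Type*} [CommRing R] (Q : Matrix ι ι R) (P : Matrix ι κ R)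
    (x y : κ → R) :
    bil (P.transpose * Q * P) x y = bil Q (P.mulVec x) (P.mulVec y) := by
  rw [bil, bil, Matrix.toBilin'_apply', Matrix.toBilin'_apply', ← Matrix.mulVec_mulVec,
    ← Matrix.mulVec_mulVec, Matrix.dotProduct_mulVec x, Matrix.vecMul_transpose]

/-- The Gram matrix of the orthogonal sum of `Q` and a hyperbolic plane. -/
def addHyp {R : Type*} [Zero R] [One R] (Q : Matrix κ κ R) :
    Matrix (κ ⊕ Fin 2) (κ ⊕ Fin 2) R :=
  Matrix.fromBlocks Q 0 0 !![0, 1; 1, 0]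

theorem bil_addHyp {R : Type*} [CommRing R] (Q : Matrix κ κ R) (x y : κ ⊕ Fin 2 → R) :
    bil (addHyp Q) x y = bil Q (fun i => x (.inl i)) (fun i => y (.inl i)) +
      (x (.inr 0) * y (.inr 1) + x (.inr 1) * y (.inr 0)) := by
  simp [bil_apply, addHyp, Fintype.sum_sum_type, Fin.sum_univ_two]

theorem addHyp_map {μ R S : Type*} [CommRing R] [CommRing S] (f : R →+* S)
    (Q : Matrix μ μ R) :
    (addHyp Q).map f = addHyp (Q.map f) := by
  rw [addHyp, addHyp, Matrix.fromBlocks_map]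
  congr 1
  · ext; simp
  · ext; simp
  · ext i j; fin_cases i <;> fin_cases j <;> simp

theorem gramNondeg_of_addHyp {Q : Matrix κ κ F} (h : GramNondeg (addHyp Q)) :
    GramNondeg Q := by
  intro x hx
  have h1 := h (Sum.elim x 0) fun y => by
    rw [bil_addHyp]
    simpa using hx _
  ext i
  exact congrFun h1 (.inl i)

theorem sim_addHyp {Q : Matrix κ κ F} {a : F} (ha : a ≠ 0) (h : Sim Q a) :
    Sim (addHyp Q) a := by
  obtain ⟨f, hf⟩ := h
  let g : (Fin 2 → F) ≃ₗ[F] (Fin 2 → F) :=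
    LinearEquiv.piCongrRight fun i =>
      if i = 0 then LinearEquiv.smulOfNeZero F F a ha else LinearEquiv.refl F F
  let e := LinearEquiv.sumArrowLequivProdArrow κ (Fin 2) F F
  refine ⟨e.trans ((f.prodCongr g).trans e.symm), fun x => ?_⟩
  rw [bil_addHyp, bil_addHyp, mul_add, ← hf]
  congr 1
  simp [e, g]
  ring

theorem isMetabolicOver_of_addHyp (h2 : (2 : F) ≠ 0) {φ : F →+* Ω} {Q : Matrix κ κ F}
    (h : IsMetabolicOver φ (addHyp Q)) : IsMetabolicOver φ Q := by
  obtain ⟨W, hW, hdim⟩ := h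
  rw [addHyp_map] at hW
  have h2' : (2 : Ω) ≠ 0 := by
    rw [← map_ofNat φ 2]
    exact (map_ne_zero φ).mpr h2
  let e : κ ⊕ Fin 2 → Ω := Pi.single (.inr 0) 1
  let l : (κ ⊕ Fin 2 → Ω) →ₗ[Ω] Ω := LinearMap.proj (.inr 1)
  let r : (κ ⊕ Fin 2 → Ω) →ₗ[Ω] (κ → Ω) := LinearMap.funLeft Ω Ω Sum.inl
  have hker : ∀ u, l u = 0 → r u = 0 → u = u (.inr 0) • e := fun u hl hr => by
    ext (i | i)
    · simpa [e] using (show u (.inl i) = 0 from congrFun hr i)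
    · fin_cases i
      · simp [e]
      · simpa [e] using (show u (.inr 1) = 0 from hl)
  have he0 : e ≠ 0 := fun h => by simpa [e] using congrFun h (.inr 0)
  have hmain : Module.finrank Ω W ≤ Module.finrank Ω ((W ⊓ LinearMap.ker l).map r) + 1 := by
    by_cases he : e ∈ W
    · have hle : W ⊓ LinearMap.ker l = W := by
        refine inf_eq_left.mpr fun u hu => ?_
        have h1 := hW u hu
        have h3 := hW (u + e) (W.add_mem hu he)
        rw [bil_addHyp] at h1 h3
        simp only [Pi.add_apply, e, Pi.single_eq_same, ne_eq, reduceCtorEq, not_false_eq_true,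
          Pi.single_eq_of_ne, add_zero, Sum.inr.injEq, one_ne_zero] at h3
        refine (mul_eq_zero.mp (?_ : 2 * u (.inr 1) = 0)).resolve_left h2'
        linear_combination h3 - h1
      have hle' : LinearMap.ker (r.domRestrict W) ≤ Submodule.span Ω {⟨e, he⟩} := by
        intro u hu
        refine Submodule.mem_span_singleton.mpr ⟨u.1 (.inr 0), Subtype.ext ?_⟩
        exact (hker _ (hle.ge u.2).2 hu).symm
      have h1 := LinearMap.finrank_range_add_finrank_ker (r.domRestrict W)
      have h3 := (Submodule.finrank_mono hle').trans_eq
        (finrank_span_singleton (Subtype.coe_ne_coe.mp he0))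
      rw [LinearMap.range_domRestrict] at h1
      rw [hle]
      lia
    · have h1 := LinearMap.finrank_range_add_finrank_ker (l.domRestrict W)
      have h3 : Module.finrank Ω (LinearMap.range (l.domRestrict W)) ≤ 1 :=
        (Submodule.finrank_le _).trans_eq (Module.finrank_self Ω)
      have h4 : Module.finrank Ω (LinearMap.ker (l.domRestrict W)) =
          Module.finrank Ω (W ⊓ LinearMap.ker l : Submodule Ω _) := by
        rw [← Submodule.map_comap_subtype, LinearEquiv.finrank_eq
          (Submodule.equivSubtypeMap W (LinearMap.ker (l.domRestrict W)))]
        rfl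
      have h5 : Module.finrank Ω ((W ⊓ LinearMap.ker l).map r) =
          Module.finrank Ω (W ⊓ LinearMap.ker l : Submodule Ω _) := by
        rw [← LinearMap.range_domRestrict]
        refine LinearMap.finrank_range_of_inj ?_
        rw [← LinearMap.ker_eq_bot, LinearMap.ker_eq_bot']
        intro u hu
        have h6 := hker _ u.2.2 hu
        by_cases ht : u.1 (.inr 0) = 0
        · rw [ht, zero_smul] at h6
          exact Subtype.ext h6
        · refine (he ?_).elim
          have h7 := W.smul_mem (u.1 (.inr 0))⁻¹ u.2.1
          nth_rewrite 2 [h6] at h7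
          rwa [smul_smul, inv_mul_cancel₀ ht, one_smul] at h7
      lia
  refine ⟨(W ⊓ LinearMap.ker l).map r, ?_, ?_⟩
  · rintro _ ⟨u, ⟨hu, hl⟩, rfl⟩
    have h1 := hW u hu
    have h3 : u (.inr 1) = 0 := hl
    rw [bil_addHyp, h3, mul_zero, zero_mul, add_zero, add_zero] at h1
    exact h1
  · rw [Fintype.card_sum, Fintype.card_fin] at hdim
    lia

variable [DecidableEq ι] [DecidableEq κ]

theorem bil_single {R : Type*} [CommRing R] (Q : Matrix ι ι R) (i j : ι) :
    bil Q (Pi.single i 1) (Pi.single j 1) = Q i j := by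
  simp [bil_apply, Pi.single_apply]

/-- The equivalence given by an invertible matrix between different index types. -/
def mulVecEquiv {R : Type*} [CommRing R] {P : Matrix ι κ R} {P' : Matrix κ ι R}
    (h : P * P' = 1) (h' : P' * P = 1) : (κ → R) ≃ₗ[R] (ι → R) :=
  LinearEquiv.ofLinearMap P.mulVecLin P'.mulVecLin
    (by rw [← Matrix.mulVecLin_mul, h, Matrix.mulVecLin_one])
    (by rw [← Matrix.mulVecLin_mul, h', Matrix.mulVecLin_one])

theorem sim_of_sim_congruence {Q : Matrix ι ι F} {P : Matrix ι κ F} {P' : Matrix κ ι F}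
    (h : P * P' = 1) (h' : P' * P = 1) {a : F} (hs : Sim (P.transpose * Q * P) a) :
    Sim Q a := by
  obtain ⟨f, hf⟩ := hs
  let e := mulVecEquiv h h'
  refine ⟨e.symm.trans (f.trans e), fun x => ?_⟩
  have h1 := hf (e.symm x)
  rw [bil_congruence, bil_congruence] at h1
  have h3 : P.mulVec (e.symm x) = x := e.apply_symm_apply x
  rw [h3] at h1
  exact h1

theorem IsMetabolicOver.congruence {Q : Matrix ι ι F} {P : Matrix ι κ F} {P' : Matrix κ ι F}
    (h : P * P' = 1) (h' : P' * P = 1) {φ : F →+* Ω} (hQ : IsMetabolicOver φ Q) :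
    IsMetabolicOver φ (P.transpose * Q * P) := by
  obtain ⟨W, hW, hdim⟩ := hQ
  have hm : P.map φ * P'.map φ = 1 := by
    rw [← Matrix.map_mul, h, Matrix.map_one _ φ.map_zero φ.map_one]
  have hm' : P'.map φ * P.map φ = 1 := by
    rw [← Matrix.map_mul, h', Matrix.map_one _ φ.map_zero φ.map_one]
  let e := mulVecEquiv hm hm'
  refine ⟨W.map e.symm.toLinearMap, ?_, ?_⟩
  · rintro _ ⟨w, hw, rfl⟩
    rw [Matrix.map_mul, Matrix.map_mul, Matrix.transpose_map, bil_congruence]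
    have h3 : (P.map φ).mulVec (e.symm w) = w := e.apply_symm_apply w
    exact (congrArg (fun v => bil (Q.map φ) v v) h3).trans (hW w hw)
  · have h1 : Fintype.card κ = Fintype.card ι := by
      simpa using (mulVecEquiv h h').finrank_eq
    rw [h1]
    exact hdim.trans_eq (by rw [← LinearEquiv.finrank_map_eq e.symm W])

theorem GramNondeg.congruence {Q : Matrix ι ι F} {P : Matrix ι κ F} {P' : Matrix κ ι F}
    (h : P * P' = 1) (h' : P' * P = 1) (hQ : GramNondeg Q) :
    GramNondeg (P.transpose * Q * P) := by
  intro x hx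
  let e := mulVecEquiv h h'
  refine e.map_eq_zero_iff.mp (hQ _ fun y => ?_)
  have h1 := hx (e.symm y)
  rw [bil_congruence] at h1
  have h3 : P.mulVec (e.symm y) = y := e.apply_symm_apply y
  rw [h3] at h1
  exact h1

/-- A nondegenerate isotropic form splits off a hyperbolic plane. -/
theorem exists_congruence_addHyp (h2 : (2 : F) ≠ 0) {n : ℕ} {Q : Matrix (Fin n) (Fin n) F}
    (hQs : Q.IsSymm) (hQ : GramNondeg Q) {x : Fin n → F} (hx : x ≠ 0) (hxx : bil Q x x = 0) :
    ∃ (m : ℕ) (Q' : Matrix (Fin m) (Fin m) F) (P : Matrix (Fin n) (Fin m ⊕ Fin 2) F)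
      (P' : Matrix (Fin m ⊕ Fin 2) (Fin n) F), m < n ∧ Q'.IsSymm ∧ P * P' = 1 ∧ P' * P = 1 ∧
      P.transpose * Q * P = addHyp Q' := by
  obtain ⟨y₀, hy₀⟩ : ∃ y, bil Q x y ≠ 0 := by
    by_contra! h
    exact hx (hQ x h)
  obtain ⟨y, hxy, hyy⟩ : ∃ y, bil Q x y = 1 ∧ bil Q y y = 0 := by
    refine ⟨(bil Q x y₀)⁻¹ • (y₀ - (bil Q y₀ y₀ / (2 * bil Q x y₀)) • x), ?_, ?_⟩
    · simp [hxx, hy₀]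
    · simp only [map_smul, map_sub, LinearMap.smul_apply, LinearMap.sub_apply, smul_eq_mul, hxx,
        bil_comm hQs y₀ x]
      field_simp
      ring
  have hyx : bil Q y x = 1 := by rw [bil_comm hQs, hxy]
  let g : (Fin n → F) →ₗ[F] F × F := (bil Q x).prod (bil Q y)
  have hg : LinearMap.range g = ⊤ := by
    refine LinearMap.range_eq_top.mpr fun ⟨a, b⟩ => ⟨a • y + b • x, ?_⟩
    simp [g, hxx, hxy, hyx, hyy]
  have hdim := LinearMap.finrank_range_add_finrank_ker g
  rw [hg, finrank_top, Module.finrank_prod, Module.finrank_self, Module.finrank_fin_fun] at hdim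
  set m := Module.finrank F (LinearMap.ker g) with hm
  let c : Module.Basis (Fin m) F (LinearMap.ker g) := Module.finBasis F (LinearMap.ker g)
  have hcx : ∀ i, bil Q x (c i) = 0 := fun i => congrArg Prod.fst (c i).2
  have hcy : ∀ i, bil Q y (c i) = 0 := fun i => congrArg Prod.snd (c i).2
  let b : Fin m ⊕ Fin 2 → (Fin n → F) := Sum.elim (fun i => (c i : Fin n → F)) ![x, y]
  have hb : LinearIndependent F b := by
    rw [Fintype.linearIndependent_iff]
    intro u hu
    rw [Fintype.sum_sum_type, Fin.sum_univ_two] at hu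
    simp only [b, Sum.elim_inl, Sum.elim_inr, Matrix.cons_val_zero, Matrix.cons_val_one] at hu
    have h1 : u (.inr 1) = 0 := by
      simpa [map_sum, hcx, hxx, hxy] using congrArg (bil Q x) hu
    have h0 : u (.inr 0) = 0 := by
      simpa [map_sum, hcy, hyx, hyy] using congrArg (bil Q y) hu
    rw [h0, h1, zero_smul, zero_smul, add_zero, add_zero] at hu
    have h3 : ∑ i, u (.inl i) • c i = 0 := by
      ext1
      simpa using hu
    have h4 := Fintype.linearIndependent_iff.mp c.linearIndependent _ h3
    rintro (i | i)
    · exact h4 i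
    · fin_cases i
      · exact h0
      · exact h1
  let B : Module.Basis (Fin m ⊕ Fin 2) F (Fin n → F) :=
    basisOfLinearIndependentOfCardEqFinrank hb (by simp; lia)
  have hB : ∀ k, B k = b k := fun k => by simp [B]
  let e := B.equivFun
  refine ⟨m, Matrix.of fun i j => bil Q (c i) (c j), LinearMap.toMatrix' e.symm.toLinearMap,
    LinearMap.toMatrix' e.toLinearMap, by lia, ?_, ?_, ?_, ?_⟩
  · ext i j
    exact bil_comm hQs _ _
  · rw [← LinearMap.toMatrix'_comp, LinearEquiv.symm_comp, LinearMap.toMatrix'_id]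
  · rw [← LinearMap.toMatrix'_comp, LinearEquiv.comp_symm, LinearMap.toMatrix'_id]
  · have hkl : ∀ k l, ((LinearMap.toMatrix' e.symm.toLinearMap).transpose * Q *
        LinearMap.toMatrix' e.symm.toLinearMap) k l = bil Q (b k) (b l) := fun k l => by
      rw [← bil_single (_ * Q * _), bil_congruence]
      have hcol : ∀ k, (LinearMap.toMatrix' e.symm.toLinearMap).mulVec (Pi.single k 1) = b k :=
        fun k => by
          rw [LinearMap.toMatrix'_mulVec, LinearEquiv.coe_coe, Module.Basis.equivFun_symm_apply]
          simp [hB, Pi.single_apply]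
      rw [hcol, hcol]
    ext k l
    rw [hkl]
    rcases k with k | k <;> rcases l with l | l
    · rfl
    · fin_cases l <;> simp [b, addHyp, hcx, hcy, bil_comm hQs _ x, bil_comm hQs _ y]
    · fin_cases k <;> simp [b, addHyp, hcx, hcy]
    · fin_cases k <;> fin_cases l <;> simp [b, addHyp, hxx, hyy, hxy, hyx]

/-- To prove that every metabolic form has `a` as a similarity factor, it suffices to treat
anisotropic forms. -/
theorem sim_of_isMetabolicOver (h2 : (2 : F) ≠ 0) (φ : F →+* Ω) {a : F} (ha : a ≠ 0)
    (haniso : ∀ (m : ℕ) (Q : Matrix (Fin m) (Fin m) F), Q.IsSymm →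
      (∀ x, bil Q x x = 0 → x = 0) → IsMetabolicOver φ Q → Sim Q a)
    {n : ℕ} {Q : Matrix (Fin n) (Fin n) F} (hQs : Q.IsSymm) (hQ : GramNondeg Q)
    (hW : IsMetabolicOver φ Q) : Sim Q a := by
  induction n using Nat.strong_induction_on with
  | _ n ih =>
    by_cases h : ∀ x, bil Q x x = 0 → x = 0
    · exact haniso n Q hQs h hW
    push Not at h
    obtain ⟨x, hxx, hx⟩ := h
    obtain ⟨m, Q', P, P', hm, hs, h1, h1', hP⟩ := exists_congruence_addHyp h2 hQs hQ hx hxx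
    refine sim_of_sim_congruence h1 h1' ?_
    rw [hP]
    refine sim_addHyp ha (ih m hm hs (gramNondeg_of_addHyp ?_) (isMetabolicOver_of_addHyp h2 ?_))
    · rw [← hP]
      exact hQ.congruence h1 h1'
    · rw [← hP]
      exact hW.congruence h1 h1'

end HyperbolicReduction

section HahnSeries

open HahnSeries

variable (Γ F : Type*) [AddCommGroup Γ] [LinearOrder Γ] [IsOrderedAddMonoid Γ] [Field F]

/-- The valuation ring of Hahn series of nonnegative order. -/
noncomputable def hahnRing : ValuationSubring (HahnSeries Γ F) where
  carrier := {x | 0 ≤ x.orderTop}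
  mul_mem' {x y} hx hy := by
    simp only [Set.mem_ofPred_eq] at hx hy ⊢
    exact (add_nonneg hx hy).trans orderTop_add_le_mul
  one_mem' := by simp
  add_mem' {x y} hx hy := by
    simp only [Set.mem_ofPred_eq] at hx hy ⊢
    exact (le_min hx hy).trans min_orderTop_le_orderTop_add
  zero_mem' := by simp
  neg_mem' {x} hx := by simpa using hx
  mem_or_inv_mem' x := by
    rcases eq_or_ne x 0 with rfl | hx
    · simp
    have h : x.order + x⁻¹.order = 0 := by
      rw [← order_mul hx (inv_ne_zero hx), mul_inv_cancel₀ hx, order_one]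
    simp only [Set.mem_ofPred_eq, zero_le_orderTop_iff]
    rcases le_total 0 x.order with h0 | h0
    · exact Or.inl h0
    · exact Or.inr (by rw [eq_neg_of_add_eq_zero_right h]; exact neg_nonneg.2 h0)

variable {Γ F}

theorem mem_hahnRing {x : HahnSeries Γ F} : x ∈ hahnRing Γ F ↔ 0 ≤ x.orderTop :=
  Set.mem_ofPred

theorem coeff_zero_mul {x y : HahnSeries Γ F} (hx : 0 ≤ x.orderTop) (hy : 0 ≤ y.orderTop) :
    (x * y).coeff 0 = x.coeff 0 * y.coeff 0 := by
  rw [coeff_mul]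
  have key : ∀ ij ∈ Finset.antidiagonal x.isPWO_support y.isPWO_support (0 : Γ), ij = (0, 0) := by
    rintro ⟨i, j⟩ hij
    obtain ⟨hi, hj, h⟩ := Finset.mem_antidiagonal.1 hij
    have hi' : 0 ≤ i := WithTop.coe_le_coe.1 (hx.trans (orderTop_le_of_coeff_ne_zero hi))
    have hj' : 0 ≤ j := WithTop.coe_le_coe.1 (hy.trans (orderTop_le_of_coeff_ne_zero hj))
    simpa using (add_eq_zero_iff_of_nonneg hi' hj').1 h
  refine Finset.sum_eq_single (0, 0) (fun ij hij hne => absurd (key ij hij) hne) fun h0 => ?_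
  by_contra hne
  refine h0 (Finset.mem_antidiagonal.2 ⟨left_ne_zero_of_mul hne, right_ne_zero_of_mul hne, ?_⟩)
  simp

variable (Γ F)

/-- The residue map of `hahnRing`. -/
noncomputable def hahnResidue : hahnRing Γ F →+* F where
  toFun x := x.1.coeff 0
  map_one' := by simp
  map_zero' := by simp
  map_add' x y := by simp
  map_mul' x y := coeff_zero_mul (mem_hahnRing.1 x.2) (mem_hahnRing.1 y.2)

/-- The constants of `hahnRing`. -/
noncomputable def hahnConst : F →+* hahnRing Γ F :=
  (C (Γ := Γ) (R := F)).codRestrict (hahnRing Γ F) fun a => mem_hahnRing.2 (by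
    rw [C_apply]; exact orderTop_single_le)

variable {Γ F}

theorem hahnResidue_const (a : F) : hahnResidue Γ F (hahnConst Γ F a) = a := by
  simp [hahnResidue, hahnConst]

theorem isUnit_of_hahnResidue_ne_zero (z : hahnRing Γ F) (hz : hahnResidue Γ F z ≠ 0) :
    IsUnit z := by
  have hz' : z.1.coeff 0 ≠ 0 := hz
  have h0 : z.1 ≠ 0 := fun h => hz' (by rw [h]; simp)
  have h1 : z.1.order = 0 :=
    le_antisymm (order_le_of_coeff_ne_zero hz') (zero_le_orderTop_iff.1 (mem_hahnRing.1 z.2))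
  have h : z.1.order + z.1⁻¹.order = 0 := by
    rw [← order_mul h0 (inv_ne_zero h0), mul_inv_cancel₀ h0, order_one]
  have hm : z.1⁻¹ ∈ hahnRing Γ F := by
    rw [mem_hahnRing, zero_le_orderTop_iff]
    rw [h1, zero_add] at h
    exact h.ge
  exact IsUnit.of_mul_eq_one ⟨_, hm⟩ (Subtype.ext (mul_inv_cancel₀ h0))

theorem single_mem_hahnRing {g : Γ} (hg : 0 ≤ g) (a : F) : single g a ∈ hahnRing Γ F :=
  mem_hahnRing.2 ((WithTop.coe_le_coe.2 hg).trans orderTop_single_le)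

theorem hahnResidue_single {g : Γ} (hg : 0 < g) (a : F) :
    hahnResidue Γ F ⟨single g a, single_mem_hahnRing hg.le a⟩ = 0 :=
  coeff_single_of_ne hg.ne

variable {σ : Type*} [Fintype σ] [DecidableEq σ]

/-- Independent monomials of a Hahn series field are algebraically independent. -/
theorem aeval_single_injective (e : σ → Γ)
    (he : Function.Injective fun β : σ →₀ ℕ => ∑ i, β i • e i) :
    Function.Injective
      (MvPolynomial.aeval (R := F) fun i => (single (e i) 1 : HahnSeries Γ F)) := by
  rw [injective_iff_map_eq_zero]
  intro f hf
  ext β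
  have key : (MvPolynomial.aeval (R := F) (fun i => (single (e i) 1 : HahnSeries Γ F)) f) =
      ∑ d ∈ f.support, single (∑ i, d i • e i) (f.coeff d) := by
    rw [MvPolynomial.aeval_def, MvPolynomial.eval₂_eq']
    refine Finset.sum_congr rfl fun d _ => ?_
    have : ∏ i, (single (e i) 1 : HahnSeries Γ F) ^ d i = single (∑ i, d i • e i) 1 := by
      simp only [single_pow, one_pow]
      induction (Finset.univ : Finset σ) using Finset.induction_on with
      | empty => simp
      | insert a s ha ih =>
        rw [Finset.prod_insert ha, Finset.sum_insert ha, ih, single_mul_single, one_mul]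
    rw [this, HahnSeries.algebraMap_apply, C_apply, single_mul_single]
    simp
  have h := congrArg (fun x => HahnSeries.coeff x (∑ i, β i • e i)) (key.symm.trans hf)
  simp only [coeff_sum, coeff_zero] at h
  rw [Finset.sum_eq_single β] at h
  · simpa using h
  · intro d _ hd
    exact coeff_single_of_ne fun hh => hd (he hh).symm
  · intro hβ
    simp [MvPolynomial.notMem_support_iff.1 hβ]

end HahnSeries

section GenericPoint

variable {F H : Type*} [Field F] [Field H] {m : ℕ} {c : H}

/-- Evaluation at the point `(√c, ψ X₁, …, ψ Xₘ)` over `H(√c)`. -/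
noncomputable def evalSqrt (c : H) (ψ : MvPolynomial (Fin m) F →+* H) :
    MvPolynomial (Fin (m + 1)) F →+* QuadraticAlgebra H c 0 :=
  MvPolynomial.eval₂Hom (((algebraMap H (QuadraticAlgebra H c 0)).comp ψ).comp MvPolynomial.C)
    (Fin.cons ⟨0, 1⟩ fun i => algebraMap H (QuadraticAlgebra H c 0) (ψ (MvPolynomial.X i)))

theorem evalSqrt_eq (ψ : MvPolynomial (Fin m) F →+* H) (g : MvPolynomial (Fin (m + 1)) F) :
    evalSqrt c ψ g = Polynomial.eval₂ ((algebraMap H (QuadraticAlgebra H c 0)).comp ψ) ⟨0, 1⟩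
      (MvPolynomial.finSuccEquiv F m g) := by
  have : evalSqrt c ψ = (Polynomial.eval₂RingHom
      ((algebraMap H (QuadraticAlgebra H c 0)).comp ψ) ⟨0, 1⟩).comp
      (MvPolynomial.finSuccEquiv F m : MvPolynomial (Fin (m + 1)) F →+* _) := by
    refine MvPolynomial.ringHom_ext (fun a => ?_) fun i => ?_
    · simp [evalSqrt, MvPolynomial.finSuccEquiv_apply]
    · refine Fin.cases ?_ (fun i => ?_) i
      · simp [evalSqrt, MvPolynomial.finSuccEquiv_X_zero]
      · simp [evalSqrt, MvPolynomial.finSuccEquiv_X_succ]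
  rw [this]
  rfl

theorem finSuccEquiv_formPoly {p : Fin (m + 1) → F} (hp : p 0 ≠ 0) :
    MvPolynomial.finSuccEquiv F m (formPoly p) = Polynomial.C (MvPolynomial.C (p 0)) *
      (Polynomial.X ^ 2 - Polynomial.C
        (-MvPolynomial.C (p 0)⁻¹ * formPoly fun i : Fin m => p i.succ)) := by
  have h : (MvPolynomial.C (p 0) * MvPolynomial.C (p 0)⁻¹ : MvPolynomial (Fin m) F) = 1 := by
    rw [← map_mul, mul_inv_cancel₀ hp, map_one]
  have h' : ∀ a, MvPolynomial.finSuccEquiv F m (MvPolynomial.C a) =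
      Polynomial.C (MvPolynomial.C a) := fun a => by simp [MvPolynomial.finSuccEquiv_apply]
  have h1 : MvPolynomial.finSuccEquiv F m (formPoly p) =
      Polynomial.C (MvPolynomial.C (p 0)) * Polynomial.X ^ 2 +
        Polynomial.C (formPoly fun i : Fin m => p i.succ) := by
    simp [formPoly, Fin.sum_univ_succ, MvPolynomial.finSuccEquiv_X_zero,
      MvPolynomial.finSuccEquiv_X_succ, h', map_sum]
  rw [h1, mul_sub, ← map_mul (Polynomial.C)]
  rw [show MvPolynomial.C (p 0) * (-MvPolynomial.C (p 0)⁻¹ * formPoly fun i : Fin m => p i.succ) =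
    -(MvPolynomial.C (p 0) * MvPolynomial.C (p 0)⁻¹) * formPoly fun i : Fin m => p i.succ by ring, h]
  simp

theorem evalSqrt_eq_zero_iff {p : Fin (m + 1) → F} (hp : p 0 ≠ 0)
    {ψ : MvPolynomial (Fin m) F →+* H} (hψ : Function.Injective ψ)
    (hc : ψ (-MvPolynomial.C (p 0)⁻¹ * formPoly fun i : Fin m => p i.succ) = c)
    (g : MvPolynomial (Fin (m + 1)) F) : evalSqrt c ψ g = 0 ↔ formPoly p ∣ g := by
  set b := -MvPolynomial.C (p 0)⁻¹ * formPoly fun i : Fin m => p i.succ with hb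
  have hu : IsUnit (Polynomial.C (MvPolynomial.C (p 0)) :
      Polynomial (MvPolynomial (Fin m) F)) :=
    ((isUnit_iff_ne_zero.2 hp).map MvPolynomial.C).map Polynomial.C
  have hroot : Polynomial.eval₂ ((algebraMap H (QuadraticAlgebra H c 0)).comp ψ) ⟨0, 1⟩
      (Polynomial.X ^ 2 - Polynomial.C b) = 0 := by
    simp only [Polynomial.eval₂_sub, Polynomial.eval₂_pow, Polynomial.eval₂_X, Polynomial.eval₂_C,
      RingHom.comp_apply, hc]
    ext <;> simp [pow_two, QuadraticAlgebra.algebraMap_eq]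
  have hmonic : (Polynomial.X ^ 2 - Polynomial.C b).Monic :=
    Polynomial.monic_X_pow_sub_C _ two_ne_zero
  have hdvd : formPoly p ∣ g ↔
      Polynomial.X ^ 2 - Polynomial.C b ∣ MvPolynomial.finSuccEquiv F m g := by
    rw [← map_dvd_iff (MvPolynomial.finSuccEquiv F m), finSuccEquiv_formPoly hp,
      hu.mul_left_dvd]
  rw [hdvd, evalSqrt_eq]
  set G := MvPolynomial.finSuccEquiv F m g
  constructor
  · intro h
    rw [← Polynomial.modByMonic_eq_zero_iff_dvd hmonic]
    have hdeg : (G %ₘ (Polynomial.X ^ 2 - Polynomial.C b)).natDegree ≤ 1 := by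
      have := Polynomial.natDegree_modByMonic_lt G hmonic (fun h1 => by
        have := congrArg Polynomial.natDegree h1
        rw [Polynomial.natDegree_X_pow_sub_C] at this
        simp at this)
      rw [Polynomial.natDegree_X_pow_sub_C] at this
      omega
    obtain ⟨a₁, a₀, ha⟩ := Polynomial.exists_eq_X_add_C_of_natDegree_le_one hdeg
    rw [← Polynomial.modByMonic_add_div G (Polynomial.X ^ 2 - Polynomial.C b),
      Polynomial.eval₂_add, Polynomial.eval₂_mul, hroot, zero_mul, add_zero, ha] at h
    simp only [Polynomial.eval₂_add, Polynomial.eval₂_mul, Polynomial.eval₂_C,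
      Polynomial.eval₂_X, RingHom.comp_apply] at h
    have hre := congrArg QuadraticAlgebra.re h
    have him := congrArg QuadraticAlgebra.im h
    simp [QuadraticAlgebra.algebraMap_eq] at hre him
    rw [map_eq_zero_iff _ hψ] at hre him
    rw [ha, hre, him]
    simp
  · rintro ⟨G', hG'⟩
    rw [hG', Polynomial.eval₂_mul, hroot, zero_mul]

theorem exists_funField_hom [Fact (∀ r : H, r ^ 2 ≠ c + 0 * r)] {p : Fin (m + 1) → F}
    (hp : p 0 ≠ 0) {ψ : MvPolynomial (Fin m) F →+* H} (hψ : Function.Injective ψ)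
    (hc : ψ (-MvPolynomial.C (p 0)⁻¹ * formPoly fun i : Fin m => p i.succ) = c) :
    ∃ φ : FunField p →+* QuadraticAlgebra H c 0, ∀ a, φ (algebraMap F (FunField p) a) =
      algebraMap H (QuadraticAlgebra H c 0) (ψ (MvPolynomial.C a)) := by
  have h0 := evalSqrt_eq_zero_iff hp hψ hc
  let θ : CoordRing p →+* QuadraticAlgebra H c 0 :=
    Ideal.Quotient.lift _ (evalSqrt c ψ) fun g hg => (h0 g).2 (Ideal.mem_span_singleton.1 hg)
  have hθ : Function.Injective θ := by
    rw [injective_iff_map_eq_zero]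
    intro g hg
    obtain ⟨g, rfl⟩ := Ideal.Quotient.mk_surjective g
    rw [Ideal.Quotient.lift_mk] at hg
    exact Ideal.Quotient.eq_zero_iff_mem.2 (Ideal.mem_span_singleton.2 ((h0 g).1 hg))
  have hunit : ∀ y : nonZeroDivisors (CoordRing p), IsUnit (θ y) := fun y =>
    isUnit_iff_ne_zero.2 fun h => by
      have : Nontrivial (CoordRing p) := θ.domain_nontrivial
      exact nonZeroDivisors.coe_ne_zero y (hθ (h.trans (map_zero θ).symm))
  refine ⟨IsLocalization.lift hunit, fun a => ?_⟩
  rw [IsScalarTower.algebraMap_apply F (CoordRing p) (FunField p), IsLocalization.lift_eq]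
  change Ideal.Quotient.lift _ _ _ (Ideal.Quotient.mk _ (MvPolynomial.C a)) = _
  rw [Ideal.Quotient.lift_mk]
  simp [evalSqrt]

end GenericPoint

section Hyperbolic

theorem bil_diagonal {R : Type*} [CommRing R] {n : ℕ} (d : Fin n → R) (x y : Fin n → R) :
    bil (Matrix.diagonal d) x y = ∑ l, d l * (x l * y l) := by
  rw [bil_apply]
  refine Finset.sum_congr rfl fun l _ => ?_
  rw [Finset.sum_eq_single l]
  · rw [Matrix.diagonal_apply_eq]; ring
  · intro j _ hj
    rw [Matrix.diagonal_apply_ne' _ hj]; ring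
  · simp

theorem bil_diagonal_self {R : Type*} [CommRing R] {n : ℕ} (d : Fin n → R) (x : Fin n → R) :
    bil (Matrix.diagonal d) x x = evalQF d x := by
  rw [bil_diagonal]
  exact Finset.sum_congr rfl fun l _ => by rw [pow_two]

theorem evalQF_hypform_append {R : Type*} [CommRing R] {k : ℕ} (c : Fin k → R) :
    evalQF (hypform k) (Fin.append c c) = 0 := by
  simp [evalQF, hypform, Fin.sum_univ_add, -Fin.natAdd_eq_addNat]

theorem isMetabolicOver_of_isHyperbolic {F K Ω : Type*} [Field F] [CommRing K] [Field Ω]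
    (h2 : (2 : Ω) ≠ 0) (φ : F →+* K) (χ : K →+* Ω) {n : ℕ} {q : Fin n → F}
    (h : IsHyperbolic (bc φ q)) : IsMetabolicOver (χ.comp φ) (Matrix.diagonal q) := by
  obtain ⟨k, f, hf⟩ := h
  have : Nontrivial K := χ.domain_nontrivial
  have hn : n = k + k := by simpa using f.finrank_eq
  let ν : (Fin k → K) →ₗ[K] (Fin n → K) := f.symm.toLinearMap ∘ₗ
    (LinearMap.funLeft K K (fun i : Fin (k + k) => Fin.append id id i))
  have hν : ∀ c, f (ν c) = Fin.append c c := fun c => by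
    simp only [ν, LinearMap.comp_apply, LinearEquiv.coe_coe, LinearEquiv.apply_symm_apply]
    ext i
    refine Fin.addCases (fun i => ?_) (fun i => ?_) i <;> 
      simp [LinearMap.funLeft_apply, -Fin.natAdd_eq_addNat]
  have hiso : ∀ c, bil (Matrix.diagonal (bc φ q)) (ν c) (ν c) = 0 := fun c => by
    rw [bil_diagonal_self, ← hf, hν, evalQF_hypform_append]
  let w : Fin k → Fin n → K := fun i => ν (Pi.single i 1)
  have hw : ∀ i j, χ (bil (Matrix.diagonal (bc φ q)) (w i) (w j)) = 0 := fun i j => by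
    have h := hiso (Pi.single i 1 + Pi.single j 1)
    simp only [map_add, LinearMap.add_apply, hiso] at h
    rw [bil_comm (Matrix.isSymm_diagonal _) (ν (Pi.single j 1))] at h
    have h' := congrArg χ h
    simp only [map_add, map_zero, zero_add, add_zero] at h'
    rw [← two_mul] at h'
    exact (mul_eq_zero.1 h').resolve_left h2
  let A := LinearMap.toMatrix' f.toLinearMap
  have hA : ∀ i j, ∑ l, χ (A (Fin.castAdd k j) l) * χ (w i l) = if j = i then 1 else 0 := by
    intro i j
    have h := congrFun (LinearMap.toMatrix'_mulVec f.toLinearMap (w i)) (Fin.castAdd k j)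
    rw [LinearEquiv.coe_coe, hν, Fin.append_left] at h
    have h' := congrArg χ h
    rw [Matrix.mulVec, dotProduct, map_sum] at h'
    simp only [map_mul] at h'
    rw [h', Pi.single_apply]
    split_ifs <;> simp
  let L : (Fin k → Ω) →ₗ[Ω] (Fin n → Ω) :=
    Fintype.linearCombination Ω (fun i l => χ (w i l))
  have hL : ∀ c l, L c l = ∑ i, c i * χ (w i l) := fun c l => by
    simp [L, Fintype.linearCombination_apply]
  have hinj : Function.Injective L := by
    rw [injective_iff_map_eq_zero]
    intro c hc
    ext j
    have : ∑ l, χ (A (Fin.castAdd k j) l) * L c l = c j := by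
      simp only [hL, Finset.mul_sum]
      rw [Finset.sum_comm]
      simp_rw [mul_left_comm, ← Finset.mul_sum, hA]
      simp
    rw [← this, hc]
    simp
  refine ⟨LinearMap.range L, ?_, ?_⟩
  · rintro _ ⟨c, rfl⟩
    have hLc : L c = ∑ i, c i • (fun l => χ (w i l)) := Fintype.linearCombination_apply _ _ _
    rw [hLc]
    simp only [map_sum, LinearMap.sum_apply, map_smul, LinearMap.smul_apply]
    refine Finset.sum_eq_zero fun i _ => ?_
    rw [Finset.sum_eq_zero, smul_zero]
    intro j _
    have hm : (Matrix.diagonal q).map (χ.comp φ) = (Matrix.diagonal (bc φ q)).map χ := by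
      rw [Matrix.diagonal_map (map_zero _), Matrix.diagonal_map (map_zero _)]
      rfl
    rw [hm, ← map_bil, hw, smul_zero]
  · rw [LinearMap.finrank_range_of_inj hinj]
    simp [hn, two_mul]

end Hyperbolic

section Specialization

/-- A field with an `F`-rational place at which a generic point specializes to `v`. -/
theorem exists_generic_place.{u} {F : Type u} [Field F] {m : ℕ} (v : Fin m → F) :
    ∃ (H : Type u) (_ : Field H) (O : ValuationSubring H) (ρ : O →+* F)
      (ψ : MvPolynomial (Fin m) F →+* O), (∀ z : O, ρ z ≠ 0 → IsUnit z) ∧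
      Function.Injective ψ ∧ ∀ f, ρ (ψ f) = MvPolynomial.eval v f := by
  let Γ := Lex (Fin m → ℤ)
  let e : Fin m → Γ := fun i => toLex (Pi.single i 1)
  have he : ∀ i, 0 < e i := fun i => Pi.toLex_strictMono (Pi.single_pos.2 one_pos)
  have he' : Function.Injective fun β : Fin m →₀ ℕ => ∑ i, β i • e i := by
    have hsum : ∀ (β : Fin m →₀ ℕ) j, (∑ i, β i • e i) j = (β j : ℤ) := fun β j => by
      have : (∑ i, β i • e i) = toLex (∑ i, β i • (Pi.single i 1 : Fin m → ℤ)) := rfl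
      rw [this, Pi.toLex_apply, Finset.sum_apply]
      simp [Pi.single_apply]
    intro β β' h
    ext j
    have := congrFun (congrArg ofLex h) j
    exact_mod_cast (hsum β j).symm.trans (this.trans (hsum β' j))
  let x : Fin m → hahnRing Γ F := fun i =>
    hahnConst Γ F (v i) + ⟨HahnSeries.single (e i) 1, single_mem_hahnRing (he i).le 1⟩
  refine ⟨HahnSeries Γ F, inferInstance, hahnRing Γ F, hahnResidue Γ F,
    MvPolynomial.eval₂Hom (hahnConst Γ F) x, isUnit_of_hahnResidue_ne_zero, ?_, fun f => ?_⟩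
  · have hτ : Function.Injective (MvPolynomial.aeval (R := F) fun i : Fin m =>
        (MvPolynomial.C (v i) + MvPolynomial.X i : MvPolynomial (Fin m) F)) := by
      refine Function.LeftInverse.injective (g := MvPolynomial.aeval (R := F) fun i : Fin m =>
        (MvPolynomial.X i - MvPolynomial.C (v i) : MvPolynomial (Fin m) F)) fun f => ?_
      rw [← AlgHom.comp_apply]
      conv_rhs => rw [← AlgHom.id_apply (R := F) f]
      congr 1
      ext i : 1
      simp [MvPolynomial.algebraMap_eq]
    have hcomp : (hahnRing Γ F).subtype.comp (MvPolynomial.eval₂Hom (hahnConst Γ F) x) =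
        (MvPolynomial.aeval (R := F) fun i => (HahnSeries.single (e i) 1 : HahnSeries Γ F) :
          MvPolynomial (Fin m) F →+* HahnSeries Γ F).comp (MvPolynomial.aeval (R := F) fun i : Fin m =>
          (MvPolynomial.C (v i) + MvPolynomial.X i : MvPolynomial (Fin m) F) :
          MvPolynomial (Fin m) F →+* MvPolynomial (Fin m) F) := by
      refine MvPolynomial.ringHom_ext (fun a => ?_) fun i => ?_
      · simp [MvPolynomial.algebraMap_eq, hahnConst, HahnSeries.algebraMap_apply]
      · simp [x, hahnConst, HahnSeries.algebraMap_apply]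
    refine Function.Injective.of_comp (f := (hahnRing Γ F).subtype) ?_
    rw [← RingHom.coe_comp, hcomp]
    exact (aeval_single_injective e he').comp hτ
  · rw [← RingHom.comp_apply]
    congr 1
    refine MvPolynomial.ringHom_ext (fun a => ?_) fun i => ?_
    · simp [hahnResidue_const]
    · simp [x, hahnResidue_const, hahnResidue_single (he i)]

variable {F : Type*} [Field F] {m n : ℕ} {p : Fin (m + 1) → F} {q : Fin n → F}

theorem map_diagonal {R S : Type*} [CommRing R] [CommRing S] (f : R →+* S) {n : ℕ}
    (d : Fin n → R) : (Matrix.diagonal d).map f = Matrix.diagonal (bc f d) := by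
  rw [Matrix.diagonal_map (map_zero f)]
  rfl

theorem gramNondeg_diagonal (hq : Nondeg q) : GramNondeg (Matrix.diagonal q) := by
  intro x hx
  ext i
  have h := hx (Pi.single i 1)
  rw [bil_diagonal, Finset.sum_eq_single i] at h
  · simpa [hq i] using h
  · intro j _ hj
    simp [hj]
  · simp

theorem bil_diagonal_eq_zero (hpan : Anisotropic p) (x : Fin (m + 1) → F)
    (hx : bil (Matrix.diagonal p) x x = 0) : x = 0 := by
  by_contra h
  exact hpan ⟨x, h, by rwa [bil_diagonal_self] at hx⟩

theorem sim_pow_two (Q : Matrix (Fin n) (Fin n) F) {l : F} (hl : l ≠ 0) : Sim Q (l ^ 2) :=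
  ⟨LinearEquiv.smulOfNeZero F _ l hl, fun x => by
    simp only [LinearEquiv.smulOfNeZero_apply, map_smul, LinearMap.smul_apply, smul_eq_mul]
    ring⟩

theorem Sim.div {Q : Matrix (Fin n) (Fin n) F} {a b : F} (ha : Sim Q a) (hb : Sim Q b)
    (hb0 : b ≠ 0) : Sim Q (a / b) := by
  obtain ⟨f, hf⟩ := ha
  obtain ⟨g, hg⟩ := hb
  refine ⟨g.symm.trans f, fun x => ?_⟩
  have h := hg (g.symm x)
  rw [LinearEquiv.apply_symm_apply] at h
  rw [LinearEquiv.trans_apply, hf, h]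
  field_simp

theorem evalQF_succ (d : Fin (m + 1) → F) (v : Fin (m + 1) → F) :
    evalQF d v = d 0 * v 0 ^ 2 + evalQF (fun i : Fin m => d i.succ) fun i => v i.succ :=
  Fin.sum_univ_succ _

theorem map_formPoly_s7 {S : Type*} [CommRing S] (ψ : MvPolynomial (Fin m) F →+* S) (d : Fin m → F) :
    ψ (formPoly d) = evalQF (bc (ψ.comp MvPolynomial.C) d) fun i => ψ (MvPolynomial.X i) := by
  simp [formPoly, evalQF, bc]

/-- If `q` becomes hyperbolic over `F(p)`, then quotients of values of `p` are similarity factors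
of `q`. -/
theorem sim_div_of_isHyperbolic (h2 : (2 : F) ≠ 0) (hp : Nondeg p) (hq : Nondeg q)
    (hpan : Anisotropic p) (hhyp : IsHyperbolic (bc (algebraMap F (FunField p)) q))
    {v : Fin (m + 1) → F} (hv : evalQF p v ≠ 0) :
    Sim (Matrix.diagonal q) (evalQF p v / p 0) := by
  rcases m with _ | m
  · have h : evalQF p v / p 0 = v 0 ^ 2 := by
      rw [evalQF_succ]
      simp [evalQF, hp 0]
    rw [h]
    refine sim_pow_two _ fun h0 => hv ?_
    rw [evalQF_succ, h0]
    simp [evalQF]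
  obtain ⟨H, _, O, ρ, ψ, hρ, hψ, hψv⟩ := exists_generic_place fun i : Fin (m + 1) => v i.succ
  let s : F →+* O := ψ.comp MvPolynomial.C
  have hs : ∀ a, ρ (s a) = a := fun a => by simp [s, hψv]
  let b : MvPolynomial (Fin (m + 1)) F :=
    -MvPolynomial.C (p 0)⁻¹ * formPoly fun i : Fin (m + 1) => p i.succ
  let c : O := ψ b
  have hψ' : Function.Injective (O.subtype.comp ψ) := Subtype.val_injective.comp hψ
  have hc : Fact (∀ r : H, r ^ 2 ≠ (c : H) + 0 * r) := ⟨fun r hr => by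
    have hb : (c : H) = -(O.subtype.comp s) (p 0)⁻¹ *
        evalQF (bc (O.subtype.comp s) fun i : Fin (m + 1) => p i.succ)
          fun i => (ψ (MvPolynomial.X i) : H) := by
      have h := map_formPoly_s7 (O.subtype.comp ψ) fun i : Fin (m + 1) => p i.succ
      change (O.subtype.comp ψ) b = _
      rw [map_mul, h, map_neg]
      rfl
    have hp0 : (O.subtype.comp s) (p 0) * (O.subtype.comp s) (p 0)⁻¹ = 1 := by
      rw [← map_mul, mul_inv_cancel₀ (hp 0), map_one]
    have hy := anisotropic_of_place hs hρ (bil_diagonal_eq_zero hpan)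
      (Fin.cons r fun i => (ψ (MvPolynomial.X i) : H)) (by
        rw [map_diagonal, bil_diagonal_self, evalQF_succ]
        unfold bc at hb ⊢
        simp only [Fin.cons_zero, Fin.cons_succ]
        rw [hr, hb]
        linear_combination -(evalQF (fun i : Fin (m + 1) => O.subtype.comp s (p i.succ))
          fun i => (ψ (MvPolynomial.X i) : H)) * hp0)
    have hX : O.subtype.comp ψ (MvPolynomial.X 0) = 0 := congrFun hy (Fin.succ 0)
    exact MvPolynomial.X_ne_zero 0 (hψ' (hX.trans (map_zero _).symm))⟩
  have h2H : (2 : H) ≠ 0 := fun h =>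
    h2 ((O.subtype.comp s).injective (by rw [map_ofNat, h, map_zero]))
  obtain ⟨χ, hχ⟩ := exists_funField_hom (hp 0) hψ' (c := (c : H)) rfl
  have hφ : χ.comp (algebraMap F (FunField p)) =
      (algebraMap H (QuadraticAlgebra H (c : H) 0)).comp (O.subtype.comp s) :=
    RingHom.ext hχ
  have h2Ω : (2 : QuadraticAlgebra H (c : H) 0) ≠ 0 := fun h =>
    h2H ((algebraMap H (QuadraticAlgebra H (c : H) 0)).injective (by rw [map_ofNat, h, map_zero]))
  have hmet := isMetabolicOver_of_isHyperbolic h2Ω _ χ hhyp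
  have hval : evalQF p v / p 0 = v 0 ^ 2 - ρ c := by
    have : ρ c = -(p 0)⁻¹ * evalQF (fun i : Fin (m + 1) => p i.succ) fun i => v i.succ := by
      rw [hψv, map_mul, map_formPoly_s7]
      simp [evalQF, bc]
    have hp0 := hp 0
    rw [this, evalQF_succ]
    field_simp
    ring
  have hval0 : evalQF p v / p 0 ≠ 0 := div_ne_zero hv (hp 0)
  refine sim_of_isMetabolicOver h2 _ hval0 (fun k Q hQs hQ hW => ?_) (Matrix.isSymm_diagonal q)
    (gramNondeg_diagonal hq) hmet
  obtain ⟨W, hW, hdim⟩ := hW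
  rw [hφ] at hW
  have hQs' : (Q.map (O.subtype.comp s)).IsSymm := hQs.map _
  obtain ⟨S, hS, hS'⟩ := exists_skew_similitude h2H hQs' (anisotropic_of_place hs hρ hQ) W
    (fun w hw => by
      rw [Matrix.map_map]
      exact hW w hw) hdim
  rw [hval] at hval0 ⊢
  exact sim_of_skew_similitude hs hρ hQs hQ c S hS hS' hval0

end Specialization

section TensorProduct

variable {F : Type*} [Field F] {n : ℕ}

theorem evalQF_tensorQF {k : ℕ} (d : Fin k → F) (p : Fin n → F) (v : Fin (k * n) → F) :
    evalQF (tensorQF d p) v =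
      ∑ i, d i * evalQF p fun j => v (finProdFinEquiv (i, j)) := by
  rw [evalQF, ← finProdFinEquiv.sum_comp, Fintype.sum_prod_type]
  simp only [tensorQF, Equiv.symm_apply_apply, evalQF, Finset.mul_sum, mul_assoc]

theorem exists_quotient_of_mem_Hset {p : Fin n → F} (hpan : Anisotropic p) {a : F}
    (ha : a ∈ Hset p) : ∃ u v : Fin n → F, evalQF p u ≠ 0 ∧ evalQF p v ≠ 0 ∧
      evalQF p u = a * evalQF p v := by
  obtain ⟨ha0, w, hw, h⟩ := ha
  rw [evalQF_tensorQF, Fin.sum_univ_two] at h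
  simp only [Matrix.cons_val_zero, Matrix.cons_val_one, one_mul] at h
  have haniso : ∀ x : Fin n → F, evalQF p x = 0 → x = 0 := fun x hx => by
    by_contra hne
    exact hpan ⟨x, hne, hx⟩
  refine ⟨fun j => w (finProdFinEquiv (0, j)), fun j => w (finProdFinEquiv (1, j)), ?_⟩
  have heq : evalQF p (fun j => w (finProdFinEquiv (0, j))) =
      a * evalQF p fun j => w (finProdFinEquiv (1, j)) := by linear_combination h
  have hv : evalQF p (fun j => w (finProdFinEquiv (1, j))) ≠ 0 := fun hv => hw <| by
    rw [hv, mul_zero] at heq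
    ext i
    obtain ⟨⟨i, j⟩, rfl⟩ := finProdFinEquiv.surjective i
    refine Fin.cases ?_ (fun i => ?_) i
    · exact congrFun (haniso _ heq) j
    · rw [Subsingleton.elim i 0]
      exact congrFun (haniso _ hv) j
  exact ⟨heq ▸ mul_ne_zero ha0 hv, hv, heq⟩

theorem isometric_smulQF_of_sim {q : Fin n → F} {a : F} (h : Sim (Matrix.diagonal q) a) :
    Isometric (smulQF a q) q := by
  obtain ⟨f, hf⟩ := h
  refine ⟨f, fun x => ?_⟩
  rw [← bil_diagonal_self, hf, bil_diagonal_self]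
  simp only [evalQF, smulQF, Finset.mul_sum, mul_assoc]

end TensorProduct

end QF

open QF in
/-- Fitzgerald's theorem: if `p` and `q` are forms over `F` (char `F ≠ 2`) with `p` anisotropic
and `q` becomes hyperbolic over `F(p)`, then `H_F(p) ⊆ G_F(q)`: every `a ∈ F×` such that
`⟨1,-a⟩ ⊗ p` is isotropic over `F` is a similarity factor of `q`. -/
theorem stmt_7 {F : Type*} [Field F] (h2 : (2 : F) ≠ 0)
    {np nq : ℕ} (p : Fin np → F) (q : Fin nq → F)
    (hp : Nondeg p) (hq : Nondeg q) (hp0 : 0 < np) (hq0 : 0 < nq)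
    (hpan : Anisotropic p)
    (hhyp : IsHyperbolic (bc (algebraMap F (FunField p)) q)) :
    Hset p ⊆ Gset q := by
  intro a ha
  obtain ⟨u, v, hu, hv, h⟩ := exists_quotient_of_mem_Hset hpan ha
  obtain ⟨m, rfl⟩ := Nat.exists_eq_succ_of_ne_zero hp0.ne'
  refine ⟨ha.1, isometric_smulQF_of_sim ?_⟩
  have := (sim_div_of_isHyperbolic h2 hp hq hpan hhyp hu).div
    (sim_div_of_isHyperbolic h2 hp hq hpan hhyp hv) (div_ne_zero hv (hp 0))
  rwa [div_div_div_cancel_right₀ (hp 0), h, mul_div_cancel_right₀ _ hv] at this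
end
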